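/- Let K be an infinite field with char(K) ≠ 2 and let Q be a strongly connected quiver with n vertices and d ≥ 2 arrows. Then D(Q,(2,…,2)) ≤ 3n, i.e., the algebra of invariants Inv(Q,(2,…,2)) has a minimal homogeneous system of generators all of whose elements have degree at most 3n. -/

import Mathlib

open Classical BigOperators

/-- A quiver (finite oriented graph data): a type of vertices, a type of arrows,
and source (tail `a''`) and target (head `a'`) maps. -/
structure QuiverData where
  V : Type
  A : Type
  src : A → V
  tgt : A → V

namespace QuiverData

variable (Q : QuiverData)

/-- `Q.IsPathFrom u v l` : the list of arrows `l` is a (possibly empty) path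
from `u` to `v`, i.e. `l = [a₁, …, a_s]` with `a₁'' = u`, `aᵢ' = a_{i+1}''`, `a_s' = v`. -/
def IsPathFrom : Q.V → Q.V → List Q.A → Prop
  | u, v, [] => u = v
  | u, v, a :: l => Q.src a = u ∧ IsPathFrom (Q.tgt a) v l

/-- A (non-empty) closed path in the vertex `v`. -/
def IsClosedAt (v : Q.V) (l : List Q.A) : Prop :=
  l ≠ [] ∧ Q.IsPathFrom v v l

/-- A (non-empty) closed path. -/
def IsClosed (l : List Q.A) : Prop := ∃ v, Q.IsClosedAt v l

/-- `deg_w(l)`: the degree of the closed path `l` in the vertex `w`,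
i.e. the number of `i` with `aᵢ' = w`. -/
noncomputable def vdeg (l : List Q.A) (w : Q.V) : ℕ :=
  Nat.card {i : Fin l.length // Q.tgt (l.get i) = w}

/-- `deg_b(l)`: the number of occurrences of the arrow `b` in the path `l`. -/
noncomputable def adeg (l : List Q.A) (b : Q.A) : ℕ :=
  Nat.card {i : Fin l.length // l.get i = b}

/-- The number of occurrences in `l` of arrows from the set `S`. -/
noncomputable def sdeg (l : List Q.A) (S : Set Q.A) : ℕ :=
  Nat.card {i : Fin l.length // l.get i ∈ S}

/-- A primitive closed path in `v`: a closed path without self-intersections,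
i.e. `deg_w = 1` for every vertex `w` of the path. -/
def IsPrimitiveAt (v : Q.V) (l : List Q.A) : Prop :=
  Q.IsClosedAt v l ∧ ∀ a ∈ l, Q.vdeg l (Q.tgt a) = 1

/-- A primitive closed path. -/
def IsPrimitive (l : List Q.A) : Prop := ∃ v, Q.IsPrimitiveAt v l

/-- `m(Q) = m` : `m` is the maximal degree of primitive closed paths in `Q`. -/
def MaxPrimDeg (m : ℕ) : Prop :=
  (∃ l, Q.IsPrimitive l ∧ l.length = m) ∧ ∀ l, Q.IsPrimitive l → l.length ≤ m

/-- `Q` is strongly connected: there is a closed path containing all vertices;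
a quiver with one vertex and no arrows is also strongly connected. -/
def StronglyConnected : Prop :=
  (∃ v l, Q.IsClosedAt v l ∧ ∀ w, ∃ a ∈ l, Q.tgt a = w) ∨
    (Subsingleton Q.V ∧ IsEmpty Q.A)

/-- Formal negation on the set (closed paths with a formal sign) ∪ {0};
`none` is the symbol `0`, and `some (e, l)` is `(-1)^e·l`. -/
def negO : Option (Bool × List Q.A) → Option (Bool × List Q.A)
  | none => none
  | some (e, l) => some (!e, l)

/-- The equivalence `≡` on the set of closed paths of `Q`, enlarged by an additional
symbol `0` (represented by `none`) and formal signs (`some (e, l)` is `(-1)^e·l`).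
The parameter `c2` is the proposition "the characteristic of the ground field is 2"
(so that the formal sign `(-1)^σ` is trivial exactly when `c2` holds).
It is the smallest equivalence, compatible with formal negation, such that for paths
`a`, `b` with `ab` a closed path and incident closed paths `a₁, a₂, …`:
(1) `ab ≡ ba`; (2) `a_{σ(1)}⋯a_{σ(t)} ≡ (-1)^σ a₁⋯a_t` for `t ≥ 2` and `σ ∈ S_t`
(generated here by transpositions of adjacent factors);
(3) `a₁²a₂ ≡ 0`; (4) if `c2` then `a₁² ≡ 0`, while if `¬c2` then `a₁a₂a₃a₄ ≡ 0`. -/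
inductive PEquiv (c2 : Prop) : Option (Bool × List Q.A) → Option (Bool × List Q.A) → Prop
  | refl (x) : PEquiv c2 x x
  | symm {x y} : PEquiv c2 x y → PEquiv c2 y x
  | trans {x y z} : PEquiv c2 x y → PEquiv c2 y z → PEquiv c2 x z
  | neg {x y} : PEquiv c2 x y → PEquiv c2 (Q.negO x) (Q.negO y)
  | cyc (u v : Q.V) (a b : List Q.A) (e : Bool) :
      Q.IsPathFrom u v a → Q.IsPathFrom v u b → a ++ b ≠ [] →
      PEquiv c2 (some (e, a ++ b)) (some (e, b ++ a))
  | swap (v : Q.V) (w₁ c d w₂ : List Q.A) (e : Bool) :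
      Q.IsPathFrom v v w₁ → Q.IsClosedAt v c → Q.IsClosedAt v d → Q.IsPathFrom v v w₂ →
      PEquiv c2 (some (e, w₁ ++ c ++ d ++ w₂))
        (some (if c2 then e else !e, w₁ ++ d ++ c ++ w₂))
  | sq_mul (v : Q.V) (c d : List Q.A) (e : Bool) :
      Q.IsClosedAt v c → Q.IsClosedAt v d →
      PEquiv c2 (some (e, c ++ c ++ d)) none
  | sq (v : Q.V) (c : List Q.A) (e : Bool) :
      c2 → Q.IsClosedAt v c → PEquiv c2 (some (e, c ++ c)) none
  | four (v : Q.V) (c₁ c₂ c₃ c₄ : List Q.A) (e : Bool) :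
      ¬c2 → Q.IsClosedAt v c₁ → Q.IsClosedAt v c₂ → Q.IsClosedAt v c₃ → Q.IsClosedAt v c₄ →
      PEquiv c2 (some (e, c₁ ++ c₂ ++ c₃ ++ c₄)) none
  | sign_triv (e : Bool) (l : List Q.A) :
      c2 → PEquiv c2 (some (e, l)) (some (!e, l))

/-- `l₁ ≡ l₂` for closed paths. -/
def PathEquiv (c2 : Prop) (l₁ l₂ : List Q.A) : Prop :=
  Q.PEquiv c2 (some (false, l₁)) (some (false, l₂))

/-- `l ≡ 0`. -/
def EquivZero (c2 : Prop) (l : List Q.A) : Prop :=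
  Q.PEquiv c2 (some (false, l)) none

/-! ### Invariants of quivers for the dimension vector `(2,…,2)` -/

/-- Variables `x_{ij}(a)` of the polynomial ring: for each arrow `a` the entries of the
`2 × 2` generic matrix `X_a`. -/
def Var : Type := Q.A × Fin 2 × Fin 2

variable (K : Type) [Field K]

/-- The substitution describing the base-change action of the group
`∏_{v} GL₂(K)` (given by a family of invertible matrices `g`) on the variables:
`x_{ij}(a)` is sent to the `(i,j)` entry of `g_{a'} X_a g_{a''}⁻¹`. -/
noncomputable def actVar (g : Q.V → Matrix (Fin 2) (Fin 2) K) (p : Q.Var) :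
    MvPolynomial Q.Var K :=
  ∑ k : Fin 2, ∑ l : Fin 2,
    MvPolynomial.C (g (Q.tgt p.1) p.2.1 k * (g (Q.src p.1))⁻¹ l p.2.2) *
      MvPolynomial.X (p.1, k, l)

/-- `f` belongs to the algebra of invariants `Inv(Q,(2,…,2))`. -/
def IsInvariant (f : MvPolynomial Q.Var K) : Prop :=
  ∀ g : Q.V → Matrix (Fin 2) (Fin 2) K, (∀ v, IsUnit (g v).det) →
    MvPolynomial.aeval (Q.actVar K g) f = f

/-- The space `Inv(Q,(2,…,2))⁺` of invariants without constant term (the span of the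
homogeneous invariants of positive degree). -/
def PlusSet : Set (MvPolynomial Q.Var K) :=
  {f | Q.IsInvariant K f ∧ MvPolynomial.constantCoeff f = 0}

/-- `f` is decomposable: it lies in the ideal `(Inv⁺)²`, i.e. in the `K`-span of
products of two invariants of positive degree. -/
def Decomposable (f : MvPolynomial Q.Var K) : Prop :=
  f ∈ Submodule.span K
    {x : MvPolynomial Q.Var K | ∃ p ∈ Q.PlusSet K, ∃ q ∈ Q.PlusSet K, x = p * q}

/-- The generic `2 × 2` matrix `X_a` of an arrow `a`. -/
noncomputable def genMat (a : Q.A) : Matrix (Fin 2) (Fin 2) (MvPolynomial Q.Var K) :=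
  Matrix.of fun i j => MvPolynomial.X (a, i, j)

/-- For a path `l = a₁⋯a_s`, the matrix product `X_{a_s} ⋯ X_{a_1}`. -/
noncomputable def pathMat (l : List Q.A) : Matrix (Fin 2) (Fin 2) (MvPolynomial Q.Var K) :=
  ((l.map (Q.genMat K)).reverse).prod

/-- `tr(X_{a_s} ⋯ X_{a_1})` for a path `l = a₁⋯a_s`. -/
noncomputable def pathTr (l : List Q.A) : MvPolynomial Q.Var K :=
  Matrix.trace (Q.pathMat K l)

/-- `det(X_{a_s} ⋯ X_{a_1})` for a path `l = a₁⋯a_s`. -/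
noncomputable def pathDet (l : List Q.A) : MvPolynomial Q.Var K :=
  Matrix.det (Q.pathMat K l)

/-- `σ_k(X_{a_s} ⋯ X_{a_1})`, the `k`-th coefficient of the characteristic polynomial
of the `2 × 2` matrix `X_{a_s} ⋯ X_{a_1}` (which vanishes for `k > 2`). -/
noncomputable def pathSigma (k : ℕ) (l : List Q.A) : MvPolynomial Q.Var K :=
  if k = 0 then 1 else if k = 1 then Q.pathTr K l
    else if k = 2 then Q.pathDet K l else 0

/-- `D(Q,(2,…,2))`: the maximal degree of an indecomposable homogeneous invariant,
i.e. the least upper bound for the degrees of elements of a minimal homogeneous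
system of generators of `Inv(Q,(2,…,2))`. -/
noncomputable def Dnum : ℕ :=
  sSup {k | ∃ f : MvPolynomial Q.Var K,
    Q.IsInvariant K f ∧ f.IsHomogeneous k ∧ ¬ Q.Decomposable K f}

end QuiverData

/-- `max {D(Q,(2,…,2)) | Q ∈ 𝒬(n,d,m)}` where `𝒬(n,d,m)` is the set of strongly
connected quivers with `n` vertices (vertex set `Fin n`), `d` arrows (arrow set `Fin d`)
and maximal degree of primitive closed paths equal to `m`. -/
noncomputable def QuiverData.maxD (K : Type) [Field K] (n d m : ℕ) : ℕ :=
  sSup {N | ∃ s t : Fin d → Fin n,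
    (QuiverData.mk (Fin n) (Fin d) s t).StronglyConnected ∧
    (QuiverData.mk (Fin n) (Fin d) s t).MaxPrimDeg m ∧
    N = (QuiverData.mk (Fin n) (Fin d) s t).Dnum K}

namespace QFFT
open MvPolynomial

/-- weights under substitution -/
lemma wh_aeval {σ τ M M' K : Type} [Field K] [AddCommMonoid M] [AddCommMonoid M']
    (w : σ → M) (w' : τ → M') (π : M →+ M') (G : σ → MvPolynomial τ K)
    (hG : ∀ v, IsWeightedHomogeneous w' (G v) (π (w v)))
    (f : MvPolynomial σ K) (α : M) (hf : IsWeightedHomogeneous w f α) :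
    IsWeightedHomogeneous w' (aeval G f) (π α) := by
  rw [f.as_sum, map_sum]
  apply IsWeightedHomogeneous.sum
  intro m hm
  rw [aeval_monomial]
  have h1 : IsWeightedHomogeneous w' (m.prod fun i k => G i ^ k) (π α) := by
    have := IsWeightedHomogeneous.prod m.support (fun i => G i ^ (m i))
      (fun i => m i • π (w i)) (w := w') (fun i _ => (hG i).pow (m i))
    have e : (∑ i ∈ m.support, m i • π (w i)) = π α := by
      rw [← hf (mem_support_iff.mp hm), Finsupp.weight_apply, Finsupp.sum, map_sum]
      simp
    rw [e] at this
    exact this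
  have := h1.C_mul (coeff m f)
  simpa [algebraMap_eq] using this

/-- monomial homs are injective when injective on monomials -/
lemma mono_inj {σ τ K : Type} [Field K] (θ : MvPolynomial σ K →ₐ[K] MvPolynomial τ K)
    (μ : (σ →₀ ℕ) → (τ →₀ ℕ)) (hθ : ∀ m c, θ (monomial m c) = monomial (μ m) c)
    (f : MvPolynomial σ K) (hinj : Set.InjOn μ (f.support : Set (σ →₀ ℕ)))
    (h0 : θ f = 0) : f = 0 := by
  ext m
  by_contra hm
  have hm' : m ∈ f.support := mem_support_iff.mpr hm
  apply hm
  have : coeff (μ m) (θ f) = coeff m f := by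
    conv_lhs => rw [f.as_sum, map_sum, coeff_sum]
    rw [Finset.sum_eq_single m]
    · rw [hθ, coeff_monomial, if_pos rfl]
    · intro b hb hbm
      rw [hθ, coeff_monomial, if_neg]
      intro h
      exact hbm (hinj hb hm' h)
    · intro h; exact absurd hm' h
  rw [← this, h0]; simp

lemma mono_supp {σ τ K : Type} [Field K] (θ : MvPolynomial σ K →ₐ[K] MvPolynomial τ K)
    (μ : (σ →₀ ℕ) → (τ →₀ ℕ)) (hθ : ∀ m c, θ (monomial m c) = monomial (μ m) c)
    (f : MvPolynomial σ K) (m' : τ →₀ ℕ) (hm : m' ∈ (θ f).support) :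
    ∃ m ∈ f.support, μ m = m' := by
  rw [mem_support_iff, f.as_sum, map_sum, coeff_sum] at hm
  obtain ⟨m, hm1, hm2⟩ := Finset.exists_ne_zero_of_sum_ne_zero hm
  refine ⟨m, hm1, ?_⟩
  rw [hθ, coeff_monomial] at hm2
  by_contra h
  rw [if_neg h] at hm2
  exact hm2 rfl

/-- reduction modulo a 2 × 2 determinant -/
lemma nf {σ M K : Type} [Field K] [AddCommMonoid M] (a b c d : σ)
    (hab : a ≠ b) (hac : a ≠ c) (had : a ≠ d) (w : σ → M) (hw : w a + w d = w b + w c)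
    (f : MvPolynomial σ K) (α : M) (hf : IsWeightedHomogeneous w f α) :
    ∃ q r : MvPolynomial σ K, f = (X a * X d - X b * X c) * q + r ∧
      (∀ m ∈ q.support, Finsupp.weight w m + (w a + w d) = α) ∧
      IsWeightedHomogeneous w r α ∧ ∀ m ∈ r.support, m a = 0 ∨ m d = 0 := by
  have key : ∀ N : ℕ, ∀ m : σ →₀ ℕ, m a = N → ∀ k : K, Finsupp.weight w m = α →
      ∃ q r : MvPolynomial σ K, monomial m k = (X a * X d - X b * X c) * q + r ∧
      (∀ m ∈ q.support, Finsupp.weight w m + (w a + w d) = α) ∧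
      IsWeightedHomogeneous w r α ∧ ∀ m ∈ r.support, m a = 0 ∨ m d = 0 := by
    intro N
    induction N with
    | zero =>
      intro m hm k hα
      refine ⟨0, monomial m k, by simp, by simp, isWeightedHomogeneous_monomial _ _ _ hα, ?_⟩
      intro m' hm'
      have := support_monomial_subset hm'
      rw [Finset.mem_singleton] at this
      rw [this]; exact Or.inl hm
    | succ N ih =>
      intro m hm k hα
      by_cases hd : m d = 0
      · refine ⟨0, monomial m k, by simp, by simp, isWeightedHomogeneous_monomial _ _ _ hα, ?_⟩
        intro m' hm'
        have := support_monomial_subset hm'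
        rw [Finset.mem_singleton] at this
        rw [this]; exact Or.inr hd
      · obtain ⟨s, hs⟩ : ∃ s : σ →₀ ℕ, m = s + (Finsupp.single a 1 + Finsupp.single d 1) := by
          refine ⟨m - (Finsupp.single a 1 + Finsupp.single d 1), ?_⟩
          ext v
          simp only [Finsupp.add_apply, Finsupp.tsub_apply, Finsupp.single_apply]
          by_cases h1 : a = v
          · by_cases h2 : d = v
            · exact absurd (h1.trans h2.symm) had
            · subst h1; simp [h2]; omega
          · by_cases h2 : d = v
            · subst h2; simp [h1]; omega
            · simp [h1, h2]
        have hsa : s a = N := by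
          rw [hs] at hm
          simp [Finsupp.single_apply, had.symm] at hm
          exact hm
        have hws : Finsupp.weight w s + (w a + w d) = α := by
          rw [← hα, hs, map_add, map_add, Finsupp.weight_single, Finsupp.weight_single]
          simp
        obtain ⟨q, r, h1, h2, h3, h4⟩ := ih (s + (Finsupp.single b 1 + Finsupp.single c 1))
          (by simp [Finsupp.single_apply, hab.symm, hac.symm, hsa]) k (by
            rw [← hws, hw, map_add, map_add, Finsupp.weight_single, Finsupp.weight_single]; simp)
        refine ⟨monomial s k + q, r, ?_, ?_, h3, h4⟩
        · rw [mul_add, add_assoc, ← h1, hs]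
          simp only [X, monomial_mul, sub_mul]
          rw [add_comm s, add_comm s]
          simp
        · intro m' hm'
          rcases Finset.mem_union.mp (support_add hm') with h | h
          · have := support_monomial_subset h
            rw [Finset.mem_singleton] at this
            rw [this]; exact hws
          · exact h2 m' h
  have : ∀ S : Finset (σ →₀ ℕ), S ⊆ f.support → ∃ q r : MvPolynomial σ K,
      (∑ m ∈ S, monomial m (coeff m f)) = (X a * X d - X b * X c) * q + r ∧
      (∀ m ∈ q.support, Finsupp.weight w m + (w a + w d) = α) ∧
      IsWeightedHomogeneous w r α ∧ ∀ m ∈ r.support, m a = 0 ∨ m d = 0 := by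
    intro S
    induction S using Finset.induction_on with
    | empty => intro _; exact ⟨0, 0, by simp, by simp, isWeightedHomogeneous_zero _ _ _, by simp⟩
    | insert m S hm ih =>
      intro hS
      obtain ⟨q, r, h1, h2, h3, h4⟩ := ih (fun x hx => hS (Finset.mem_insert_of_mem hx))
      obtain ⟨q', r', h1', h2', h3', h4'⟩ := key (m a) m rfl (coeff m f)
        (hf (mem_support_iff.mp (hS (Finset.mem_insert_self _ _))))
      refine ⟨q' + q, r' + r, ?_, ?_, h3'.add h3, ?_⟩
      · rw [Finset.sum_insert hm, h1, h1']; ring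
      · intro m' hm'
        rcases Finset.mem_union.mp (support_add hm') with h | h
        · exact h2' m' h
        · exact h2 m' h
      · intro m' hm'
        rcases Finset.mem_union.mp (support_add hm') with h | h
        · exact h4' m' h
        · exact h4 m' h
  have h := this f.support (le_refl _)
  rwa [← f.as_sum] at h

/-- lifting lists along maps -/
lemma lift_list {H H' : Type} (φ : H → H') (α : Multiset H) (l : List H')
    (hl : (l : Multiset H') = α.map φ) : ∃ l' : List H, (l' : Multiset H) = α ∧ l'.map φ = l := by
  induction α using Quotient.inductionOn with
  | h a =>
    have hp : l.Perm (a.map φ) := by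
      apply Multiset.coe_eq_coe.mp
      simpa using hl
    have : (Relation.Comp (fun x y => x = List.map φ y) (fun x y => List.Perm x y) :
        List H' → List H → Prop) l a := by
      rw [List.eq_map_comp_perm]; exact hp
    obtain ⟨b, hb1, hb2⟩ := this
    exact ⟨b, Multiset.coe_eq_coe.mpr hb2, hb1.symm⟩

/-- bracket words -/
noncomputable def br {H V R : Type} [CommRing R] (vert : H → V) (c : H → Fin 2 → R) : List H → R
  | [] => 1
  | [_] => 0
  | a :: b :: l => (if vert a = vert b then c a 0 * c b 1 - c a 1 * c b 0 else 0) * br vert c l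

lemma br_hom {H V R S : Type} [CommRing R] [CommRing S] (vert : H → V) (c : H → Fin 2 → R)
    (θ : R →+* S) : ∀ l, θ (br vert c l) = br vert (fun h i => θ (c h i)) l
  | [] => by simp [br]
  | [_] => by simp [br]
  | a :: b :: l => by
    rw [br, br, map_mul, br_hom vert c θ l]
    split_ifs <;> simp

lemma br_map {H H' V R : Type} [CommRing R] (vert : H' → V) (c : H' → Fin 2 → R) (φ : H → H') :
    ∀ l, br vert c (l.map φ) = br (fun h => vert (φ h)) (fun h => c (φ h)) l
  | [] => by simp [br]
  | [_] => by simp [br]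
  | a :: b :: l => by
    simp only [List.map_cons, br]
    rw [br_map vert c φ l]

lemma br_wh {H V K M σ : Type} [Field K] [AddCommMonoid M] (w : σ → M) (vert : H → V)
    (c : H → Fin 2 → MvPolynomial σ K) (d : H → M)
    (hc : ∀ h i, IsWeightedHomogeneous w (c h i) (d h)) :
    ∀ l : List H, IsWeightedHomogeneous w (br vert c l) ((l.map d).sum)
  | [] => by simpa [br] using isWeightedHomogeneous_one K w
  | [_] => by simpa [br] using isWeightedHomogeneous_zero K w _
  | a :: b :: l => by
    simp only [br, List.map_cons, List.sum_cons]
    rw [← add_assoc]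
    apply IsWeightedHomogeneous.mul _ (br_wh w vert c d hc l)
    split_ifs
    · apply IsWeightedHomogeneous.sub
      · exact (hc a 0).mul (hc b 1)
      · exact (hc a 1).mul (hc b 0)
    · exact isWeightedHomogeneous_zero K w _

end QFFT

namespace QFFT
open MvPolynomial

/-- weight of a vector variable -/
def wH (H : Type) : H × Fin 2 → Multiset H := fun p => {p.1}

lemma count_wH {H : Type} (m : H × Fin 2 →₀ ℕ) (h : H) :
    Multiset.count h (Finsupp.weight (wH H) m) = m (h, 0) + m (h, 1) := by
  induction m using Finsupp.induction_linear with
  | zero => simp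
  | add f g hf hg => rw [map_add, Multiset.count_add, hf, hg]; simp; omega
  | single v n =>
    obtain ⟨h', i⟩ := v
    rw [Finsupp.weight_single, wH, Multiset.count_nsmul, Multiset.count_singleton]
    simp only [Finsupp.single_apply, Prod.mk.injEq]
    by_cases e : h = h'
    · subst e
      fin_cases i <;> simp
    · have e' : ¬ h' = h := fun x => e x.symm
      simp [e, e']

/-- action on vectors -/
noncomputable def actH {H V K : Type} [Field K] (vert : H → V) (g : V → Matrix (Fin 2) (Fin 2) K) :
    MvPolynomial (H × Fin 2) K →ₐ[K] MvPolynomial (H × Fin 2) K :=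
  aeval (fun p => ∑ k, C (g (vert p.1) p.2 k) * X (p.1, k))

lemma actH_X {H V K : Type} [Field K] (vert : H → V) (g : V → Matrix (Fin 2) (Fin 2) K)
    (h : H) (i : Fin 2) :
    actH vert g (X (h, i)) = C (g (vert h) i 0) * X (h, 0) + C (g (vert h) i 1) * X (h, 1) := by
  simp [actH]

/-- invariance under products of SL₂ -/
def InvH {H V K : Type} [Field K] (vert : H → V) (f : MvPolynomial (H × Fin 2) K) : Prop :=
  ∀ g : V → Matrix (Fin 2) (Fin 2) K, (∀ v, (g v).det = 1) → actH vert g f = f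

lemma actH_bracket {H V K : Type} [Field K] (vert : H → V) (g : V → Matrix (Fin 2) (Fin 2) K)
    (hg : ∀ v, (g v).det = 1) (a b : H) (hab : vert a = vert b) :
    actH vert g (X (a, 0) * X (b, 1) - X (a, 1) * X (b, 0)) =
      X (a, 0) * X (b, 1) - X (a, 1) * X (b, 0) := by
  have h1 := hg (vert b)
  rw [Matrix.det_fin_two] at h1
  have h2 : (C (g (vert b) 0 0) * C (g (vert b) 1 1) - C (g (vert b) 0 1) * C (g (vert b) 1 0) :
      MvPolynomial (H × Fin 2) K) = 1 := by
    rw [← C_mul, ← C_mul, ← C_sub, h1, C_1]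
  simp only [map_sub, map_mul, actH_X, hab]
  linear_combination (X (a, 0) * X (b, 1) - X (a, 1) * X (b, 0)) * h2

lemma br_inv {H V K : Type} [Field K] (vert : H → V) :
    ∀ l : List H, InvH (K := K) vert (br vert (fun h i => X (h, i)) l)
  | [] => fun g hg => by simp [br]
  | [_] => fun g hg => by simp [br]
  | a :: b :: l => fun g hg => by
    rw [br, map_mul, br_inv vert l g hg]
    split_ifs with h
    · rw [actH_bracket vert g hg a b h]
    · simp

/-- span of bracket words of given content -/
noncomputable def BS {H V K R : Type} [Field K] [CommRing R] [Algebra K R] (vert : H → V)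
    (c : H → Fin 2 → R) (α : Multiset H) : Submodule K R :=
  Submodule.span K {x | ∃ l : List H, (l : Multiset H) = α ∧ x = br vert c l}

lemma BS_inv {H V K : Type} [Field K] (vert : H → V) (α : Multiset H)
    (t : MvPolynomial (H × Fin 2) K) (ht : t ∈ BS (K := K) vert (fun h i => X (h, i)) α) :
    InvH vert t := by
  intro g hg
  induction ht using Submodule.span_induction with
  | mem x hx => obtain ⟨l, _, rfl⟩ := hx; exact br_inv vert l g hg
  | zero => simp
  | add x y _ _ hx hy => rw [map_add, hx, hy]
  | smul a x _ hx => rw [map_smul, hx]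

lemma BS_wh {H V K : Type} [Field K] (vert : H → V) (α : Multiset H)
    (t : MvPolynomial (H × Fin 2) K) (ht : t ∈ BS (K := K) vert (fun h i => X (h, i)) α) :
    IsWeightedHomogeneous (wH H) t α := by
  rw [← mem_weightedHomogeneousSubmodule]
  refine Submodule.span_le.mpr ?_ ht
  rintro x ⟨l, hl, rfl⟩
  have := br_wh (K := K) (wH H) vert (fun h i => X (h, i)) (fun h => {h})
    (fun h i => isWeightedHomogeneous_X K (wH H) (h, i)) l
  have e : (l.map (fun h => ({h} : Multiset H))).sum = α := by
    rw [← hl]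
    induction l generalizing α with
    | nil => simp
    | cons a l ih =>
      simp only [List.map_cons, List.sum_cons]
      have := br_wh (K := K) (wH H) vert (fun h i => X (h, i)) (fun h => {h})
        (fun h i => isWeightedHomogeneous_X K (wH H) (h, i)) l
      have e2 : (l.map (fun h => ({h} : Multiset H))).sum = l := by
        clear * -
        induction l with
        | nil => simp
        | cons a l ih => simp [ih]
      rw [e2]; simp
  rw [e] at this
  exact this

lemma actH_wh {H V K : Type} [Field K] (vert : H → V) (g : V → Matrix (Fin 2) (Fin 2) K)
    (f : MvPolynomial (H × Fin 2) K) {M : Type} [AddCommMonoid M] (w : H → M) (α : M)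
    (hf : IsWeightedHomogeneous (fun p : H × Fin 2 => w p.1) f α) :
    IsWeightedHomogeneous (fun p : H × Fin 2 => w p.1) (actH vert g f) α := by
  have := wh_aeval (fun p : H × Fin 2 => w p.1) (fun p : H × Fin 2 => w p.1) (AddMonoidHom.id M)
    (fun p => ∑ k, C (g (vert p.1) p.2 k) * X (p.1, k)) (fun v => by
      apply IsWeightedHomogeneous.sum
      intro k _
      exact (isWeightedHomogeneous_X K (fun p : H × Fin 2 => w p.1) (v.1, k)).C_mul _) f α hf
  exact this

/-- base case: a vector alone at its vertex -/
lemma lone_zero {H V K : Type} [Field K] [Infinite K] (vert : H → V) (α : Multiset H)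
    (f : MvPolynomial (H × Fin 2) K) (hf : IsWeightedHomogeneous (wH H) f α) (hi : InvH vert f)
    (h : H) (hh : h ∈ α) (hl : ∀ h' ∈ α, vert h' = vert h → h' = h) : f = 0 := by
  have hpos : 0 < Multiset.count h α := Multiset.count_pos.mpr hh
  set a := Multiset.count h α with ha
  obtain ⟨t, ht0, ht1⟩ : ∃ t : K, t ≠ 0 ∧ t ^ a ≠ 1 := by
    by_contra hcon
    push Not at hcon
    have hp : (Polynomial.X * (Polynomial.X ^ a - 1) : Polynomial K) = 0 := by
      apply Polynomial.funext
      intro r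
      simp only [Polynomial.eval_mul, Polynomial.eval_X, Polynomial.eval_sub, Polynomial.eval_pow,
        Polynomial.eval_one, Polynomial.eval_zero]
      by_cases hr : r = 0
      · simp [hr]
      · rw [hcon r hr]; simp
    rcases mul_eq_zero.mp hp with h1 | h1
    · exact Polynomial.X_ne_zero h1
    · exact Polynomial.X_pow_sub_C_ne_zero hpos (1 : K) (by simpa using h1)
  have hz : X (h, 0) * f = 0 := by
    apply MvPolynomial.funext
    intro p
    simp only [map_mul, eval_X, map_zero]
    by_cases hx : p (h, 0) = 0
    · simp [hx]
    · suffices hs : eval p f = 0 by rw [hs, mul_zero]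
      set x := p (h, 0)
      set y := p (h, 1) with hy
      let g : V → Matrix (Fin 2) (Fin 2) K := fun v =>
        if v = vert h then !![t, 0; (t - t⁻¹) * y / x, t⁻¹] else 1
      have hg : ∀ v, (g v).det = 1 := by
        intro v
        by_cases hv : v = vert h
        · simp [g, hv, Matrix.det_fin_two, ht0]
        · simp [g, hv]
      have h1 : eval p (actH vert g f) = eval p f := by rw [hi g hg]
      have h2 : eval p (actH vert g f) = t ^ a * eval p f := by
        have e : eval p (actH vert g f) = eval (fun q : H × Fin 2 =>
            ∑ k, g (vert q.1) q.2 k * p (q.1, k)) f := by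
          have : (eval p).comp (actH vert g : MvPolynomial (H × Fin 2) K →+* _) =
              eval (fun q : H × Fin 2 => ∑ k, g (vert q.1) q.2 k * p (q.1, k)) := by
            apply MvPolynomial.ringHom_ext
            · intro r; simp
            · intro q; simp [actH]
          exact congrArg (fun F => F f) this
        rw [e, eval_eq, eval_eq, Finset.mul_sum]
        apply Finset.sum_congr rfl
        intro m hm
        have hw := hf (mem_support_iff.mp hm)
        have hma : m (h, 0) + m (h, 1) = a := by rw [← count_wH, hw]
        have e1 : ∀ q ∈ m.support, (∑ k, g (vert q.1) q.2 k * p (q.1, k)) ^ m q =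
            (if q.1 = h then t else 1) ^ m q * p q ^ m q := by
          intro q hq
          obtain ⟨h', i⟩ := q
          have hmem : h' ∈ α := by
            rw [← Multiset.count_pos, ← hw, count_wH]
            have := Finsupp.mem_support_iff.mp hq
            fin_cases i <;> simp at this <;> omega
          rw [← mul_pow]
          congr 1
          by_cases hv : vert h' = vert h
          · have := hl h' hmem hv
            subst this
            fin_cases i
            · simp [g]
            · simp [g]
              field_simp
              ring
          · have hne : h' ≠ h := fun e => hv (by rw [e])
            simp only [g, hv, hne, if_false, Matrix.one_apply]
            simp
        rw [Finset.prod_congr rfl e1, Finset.prod_mul_distrib]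
        have e2 : ∏ q ∈ m.support, (if q.1 = h then t else 1) ^ m q = t ^ a := by
          have : ∏ q ∈ m.support, (if q.1 = h then t else 1) ^ m q =
              ∏ q ∈ ({(h, 0), (h, 1)} : Finset (H × Fin 2)), t ^ m q := by
            have h3 : ∀ S : Finset (H × Fin 2), m.support ⊆ S →
              ∏ q ∈ m.support, (if q.1 = h then t else 1) ^ m q =
                ∏ q ∈ S, (if q.1 = h then t else 1) ^ m q := by
              intro S hS
              apply Finset.prod_subset hS
              intro q _ hq
              rw [Finsupp.notMem_support_iff.mp hq, pow_zero]
            rw [h3 (m.support ∪ {(h, 0), (h, 1)}) Finset.subset_union_left]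
            symm
            rw [← Finset.prod_subset (s₁ := ({(h, 0), (h, 1)} : Finset (H × Fin 2)))
              Finset.subset_union_right]
            · apply Finset.prod_congr rfl
              intro q hq
              have : q.1 = h := by
                simp at hq
                rcases hq with rfl | rfl <;> rfl
              rw [if_pos this]
            · intro q _ hq
              obtain ⟨h', i⟩ := q
              have : h' ≠ h := by
                rintro rfl
                apply hq
                fin_cases i <;> simp
              simp [this]
          rw [this, Finset.prod_pair (by simp), ← pow_add, hma]
        rw [e2]; ring
      rw [h1] at h2
      have h3 : (t ^ a - 1) * eval p f = 0 := by linear_combination -h2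
      rcases mul_eq_zero.mp h3 with h4 | h4
      · exact absurd (sub_eq_zero.mp h4) ht1
      · exact h4
  rcases mul_eq_zero.mp hz with h1 | h1
  · exact absurd h1 (X_ne_zero _)
  · exact h1

end QFFT

namespace QFFT
open MvPolynomial

/-- quotient of homogeneous by weight -/
lemma wh_of_supp {σ M K : Type} [Field K] [AddCommMonoid M] [IsRightCancelAdd M] (w : σ → M)
    (q : MvPolynomial σ K) (α δ : M) (hq : ∀ m ∈ q.support, Finsupp.weight w m + δ = α)
    (hq0 : q ≠ 0) : ∃ β, β + δ = α ∧ IsWeightedHomogeneous w q β := by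
  obtain ⟨m, hm⟩ := support_nonempty.mpr hq0
  refine ⟨Finsupp.weight w m, hq m hm, ?_⟩
  intro d hd
  have h1 := hq d (mem_support_iff.mpr hd)
  rw [← hq m hm] at h1
  exact add_right_cancel h1

/-- identify two vectors -/
noncomputable def idf {H : Type} (h1 h2 : H) : H → H := fun h => if h = h2 then h1 else h

lemma mapDomain_idf {H : Type} (h1 h2 : H) (h12 : h1 ≠ h2) (m : H × Fin 2 →₀ ℕ) :
    (∀ i, Finsupp.mapDomain (fun p : H × Fin 2 => (idf h1 h2 p.1, p.2)) m (h1, i) =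
      m (h1, i) + m (h2, i)) ∧
    ∀ h, h ≠ h1 → h ≠ h2 → ∀ i,
      Finsupp.mapDomain (fun p : H × Fin 2 => (idf h1 h2 p.1, p.2)) m (h, i) = m (h, i) := by
  induction m using Finsupp.induction_linear with
  | zero => simp
  | add f g hf hg =>
    refine ⟨fun i => ?_, fun h ha hb i => ?_⟩
    · rw [Finsupp.mapDomain_add, Finsupp.add_apply, hf.1, hg.1]; simp; omega
    · rw [Finsupp.mapDomain_add, Finsupp.add_apply, hf.2 h ha hb, hg.2 h ha hb]; simp
  | single v n =>
    obtain ⟨h', j⟩ := v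
    refine ⟨fun i => ?_, fun h ha hb i => ?_⟩
    · rw [Finsupp.mapDomain_single]
      simp only [Finsupp.single_apply, Prod.mk.injEq, idf]
      by_cases e1 : h' = h2
      · subst e1; simp [h12.symm]
      · simp [e1]
    · rw [Finsupp.mapDomain_single]
      simp only [Finsupp.single_apply, Prod.mk.injEq, idf]
      by_cases e1 : h' = h2
      · subst e1; simp [ha.symm, hb.symm]
      · simp [e1]

lemma rename_act {H H' V K : Type} [Field K] (vert : H' → V) (φ : H → H')
    (g : V → Matrix (Fin 2) (Fin 2) K) (f : MvPolynomial (H × Fin 2) K) :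
    actH vert g (rename (fun p : H × Fin 2 => (φ p.1, p.2)) f) =
      rename (fun p : H × Fin 2 => (φ p.1, p.2)) (actH (fun h => vert (φ h)) g f) := by
  have : (actH vert g).comp (rename (fun p : H × Fin 2 => (φ p.1, p.2))) =
      (rename (fun p : H × Fin 2 => (φ p.1, p.2))).comp (actH (fun h => vert (φ h)) g) := by
    apply MvPolynomial.algHom_ext
    intro p
    simp [actH]
  exact congrArg (fun F => F f) this

lemma rename_wh {H H' K : Type} [Field K] (φ : H → H') (f : MvPolynomial (H × Fin 2) K)
    (α : Multiset H) (hf : IsWeightedHomogeneous (wH H) f α) :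
    IsWeightedHomogeneous (wH H') (rename (fun p : H × Fin 2 => (φ p.1, p.2)) f) (α.map φ) := by
  have := wh_aeval (wH H) (wH H') (Multiset.mapAddMonoidHom φ)
    (X ∘ (fun p : H × Fin 2 => (φ p.1, p.2)) : H × Fin 2 → MvPolynomial (H' × Fin 2) K)
    (fun v => isWeightedHomogeneous_X K (wH H') (φ v.1, v.2)) f α hf
  have e : rename (fun p : H × Fin 2 => (φ p.1, p.2)) f =
      aeval (X ∘ (fun p : H × Fin 2 => (φ p.1, p.2)) : H × Fin 2 → MvPolynomial (H' × Fin 2) K) f := by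
    rw [rename_eq_aeval]
  rw [e]
  exact this

lemma BS_lift {H H' V K R S : Type} [Field K] [CommRing R] [Algebra K R] [CommRing S] [Algebra K S]
    (vert : H' → V) (φ : H → H')
    (c : H' → Fin 2 → R) (c' : H → Fin 2 → S) (θ : S →ₐ[K] R) (hθ : ∀ h i, θ (c' h i) = c (φ h) i)
    (α : Multiset H) (x : R) (hx : x ∈ BS (K := K) vert c (α.map φ)) :
    ∃ t ∈ BS (K := K) (fun h => vert (φ h)) c' α, θ t = x := by
  have : BS (K := K) vert c (α.map φ) ≤
      (BS (K := K) (fun h => vert (φ h)) c' α).map θ.toLinearMap := by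
    apply Submodule.span_le.mpr
    rintro y ⟨l, hl, rfl⟩
    obtain ⟨l', h1, h2⟩ := lift_list φ α l hl
    refine ⟨br (fun h => vert (φ h)) c' l', Submodule.subset_span ⟨l', h1, rfl⟩, ?_⟩
    change θ _ = _
    rw [← h2, br_map]
    have := br_hom (fun h => vert (φ h)) c' (θ : S →+* R) l'
    simp only [RingHom.coe_coe] at this
    rw [this]
    simp only [hθ]
  obtain ⟨t, h1, h2⟩ := this hx
  exact ⟨t, h1, h2⟩

theorem fft_vec {H V K : Type} [Field K] [Infinite K] (vert : H → V) :
    ∀ (N : ℕ) (α : Multiset H), α.card + α.toFinset.card = N →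
    ∀ f : MvPolynomial (H × Fin 2) K, IsWeightedHomogeneous (wH H) f α → InvH vert f →
      f ∈ BS (K := K) vert (fun h i => X (h, i)) α := by
  intro N
  induction N using Nat.strong_induction_on with
  | _ N ih =>
  intro α hN f hf hi
  by_cases hcase : ∃ h1 ∈ α, ∃ h2 ∈ α, h1 ≠ h2 ∧ vert h1 = vert h2
  · obtain ⟨h1, hm1, h2, hm2, hne, hv⟩ := hcase
    set φ := idf h1 h2 with hφ
    have hvφ : (fun h => vert (φ h)) = vert := by
      funext h
      simp only [hφ, idf]
      split_ifs with e
      · rw [e, hv]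
      · rfl
    set fb := rename (fun p : H × Fin 2 => (φ p.1, p.2)) f with hfb
    have hfbw : IsWeightedHomogeneous (wH H) fb (α.map φ) := rename_wh φ f α hf
    have hfbi : InvH vert fb := by
      intro g hg
      rw [hfb, rename_act, hvφ, hi g hg]
    have hlt : (α.map φ).card + (α.map φ).toFinset.card < N := by
      rw [← hN, Multiset.card_map]
      apply Nat.add_lt_add_left
      apply Finset.card_lt_card
      rw [Finset.ssubset_iff_of_subset]
      · refine ⟨h2, by simpa using hm2, ?_⟩
        simp only [Multiset.mem_toFinset, Multiset.mem_map, not_exists, not_and]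
        intro x hx
        simp only [hφ, idf]
        split_ifs with e
        · exact hne
        · exact e
      · intro x hx
        simp only [Multiset.mem_toFinset, Multiset.mem_map] at hx ⊢
        obtain ⟨y, hy, rfl⟩ := hx
        simp only [hφ, idf]
        split_ifs
        · exact hm1
        · exact hy
    have hfbs := ih _ hlt (α.map φ) rfl fb hfbw hfbi
    obtain ⟨t, ht, htf⟩ := BS_lift vert φ (fun h i => X (h, i)) (fun h i => X (h, i))
      (rename (fun p : H × Fin 2 => (φ p.1, p.2))) (by intro h i; simp) α fb hfbs
    rw [hvφ] at ht
    have htw := BS_wh vert α t ht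
    have hti := BS_inv vert α t ht
    obtain ⟨q, r, e1, e2, e3, e4⟩ := nf (h1, (0 : Fin 2)) (h1, 1) (h2, 0) (h2, 1)
      (by simp) (by simp [hne]) (by simp) (wH H) (by simp [wH]) (f - t) α (hf.sub htw)
    have hr0 : rename (fun p : H × Fin 2 => (φ p.1, p.2)) r = 0 := by
      have : rename (fun p : H × Fin 2 => (φ p.1, p.2)) (f - t) = 0 := by
        rw [map_sub, htf, hfb, sub_self]
      rw [e1] at this
      simp only [map_add, map_mul, map_sub, rename_X] at this
      have e5 : φ h1 = h1 := by simp [hφ, idf]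
      have e6 : φ h2 = h1 := by simp [hφ, idf]
      rw [e5, e6] at this
      linear_combination this
    have hr : r = 0 := by
      apply mono_inj (rename (fun p : H × Fin 2 => (φ p.1, p.2)))
        (Finsupp.mapDomain (fun p : H × Fin 2 => (φ p.1, p.2)))
        (fun m c => rename_monomial _ _ _) r _ hr0
      intro m hm m' hm' hmm
      have a1 := mapDomain_idf h1 h2 hne m
      have a2 := mapDomain_idf h1 h2 hne m'
      rw [← hφ] at a1 a2
      rw [hmm] at a1
      have b1 := count_wH m h1
      have b2 := count_wH m h2
      have b3 := count_wH m' h1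
      have b4 := count_wH m' h2
      rw [e3 (mem_support_iff.mp hm)] at b1 b2
      rw [e3 (mem_support_iff.mp hm')] at b3 b4
      have c0 := (a1.1 0).symm.trans (a2.1 0)
      have c1 := (a1.1 1).symm.trans (a2.1 1)
      have d1 := e4 m hm
      have d2 := e4 m' hm'
      have key : m (h1, 0) = m' (h1, 0) ∧ m (h1, 1) = m' (h1, 1) ∧ m (h2, 0) = m' (h2, 0) ∧
          m (h2, 1) = m' (h2, 1) := by omega
      ext ⟨h, i⟩
      by_cases x1 : h = h1
      · subst x1
        fin_cases i
        · exact key.1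
        · exact key.2.1
      · by_cases x2 : h = h2
        · subst x2
          fin_cases i
          · exact key.2.2.1
          · exact key.2.2.2
        · exact (a1.2 h x1 x2 i).symm.trans (a2.2 h x1 x2 i)
    rw [hr, add_zero] at e1
    have hsum : f = t + (X (h1, 0) * X (h2, 1) - X (h1, 1) * X (h2, 0)) * q := by
      rw [← e1]; ring
    by_cases hq0 : q = 0
    · rw [hsum, hq0, mul_zero, add_zero]; exact ht
    obtain ⟨β, hβ, hqw⟩ := wh_of_supp (wH H) q α _ e2 hq0
    have hD0 : (X (h1, 0) * X (h2, 1) - X (h1, 1) * X (h2, 0) : MvPolynomial (H × Fin 2) K) ≠ 0 := by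
      intro h0
      have := congrArg (eval (fun p : H × Fin 2 => if p = (h1, 0) ∨ p = (h2, 1) then (1 : K) else 0)) h0
      simp [hne, hne.symm] at this
    have hqi : InvH vert q := by
      intro g hg
      have h5 : actH vert g (f - t) = f - t := by rw [map_sub, hi g hg, hti g hg]
      rw [e1, map_mul, actH_bracket vert g hg h1 h2 hv] at h5
      exact mul_left_cancel₀ hD0 h5
    have hβc : β.card + 2 = α.card := by rw [← hβ]; simp [wH]
    have hβf : β.toFinset.card ≤ α.toFinset.card := by
      apply Finset.card_le_card
      rw [← hβ]
      intro x hx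
      simp only [Multiset.mem_toFinset] at hx ⊢
      exact Multiset.mem_add.mpr (Or.inl hx)
    have hqs := ih _ (by omega) β rfl q hqw hqi
    rw [hsum]
    apply Submodule.add_mem _ ht
    have : BS (K := K) vert (fun h i => X (h, i)) β ≤
        (BS (K := K) vert (fun h i => X (h, i)) α).comap
          (LinearMap.mulLeft K (X (h1, 0) * X (h2, 1) - X (h1, 1) * X (h2, 0) :
            MvPolynomial (H × Fin 2) K)) := by
      apply Submodule.span_le.mpr
      rintro y ⟨l, hl, rfl⟩
      apply Submodule.subset_span
      refine ⟨h1 :: h2 :: l, ?_, ?_⟩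
      · rw [← hβ, ← hl]
        simp only [wH]
        rw [← Multiset.cons_coe, ← Multiset.cons_coe, add_comm, add_assoc,
          Multiset.singleton_add, Multiset.singleton_add]
      · simp [br, hv]
    exact this hqs
  · push Not at hcase
    by_cases h0 : α = 0
    · subst h0
      have : f = C (coeff 0 f) := by
        ext m
        rw [coeff_C]
        split_ifs with e
        · rw [e]
        · by_contra hm
          apply e
          have hw := hf hm
          ext ⟨h, i⟩
          have := count_wH m h
          rw [hw] at this
          simp at this
          fin_cases i <;> simp <;> omega
      rw [this]
      have h1 : (1 : MvPolynomial (H × Fin 2) K) ∈ BS (K := K) vert (fun h i => X (h, i)) 0 :=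
        Submodule.subset_span ⟨[], rfl, by simp [br]⟩
      have := Submodule.smul_mem _ (coeff 0 f) h1
      rwa [smul_eq_C_mul, mul_one] at this
    · obtain ⟨h, hh⟩ := Multiset.exists_mem_of_ne_zero h0
      have := lone_zero vert α f hf hi h hh (by
        intro h' hh' hv
        by_contra hne
        exact hcase h' hh' h hh hne hv)
      rw [this]
      exact Submodule.zero_mem _

end QFFT

namespace QFFT
open MvPolynomial

/-- polynomial ring on entries of generic matrices -/
abbrev RM (I K : Type) [Field K] := MvPolynomial ((I × Fin 2) × Fin 2) K

lemma aeval_monom {σ τ K : Type} [Field K] (E : σ → (τ →₀ ℕ)) (m : σ →₀ ℕ) (c : K) :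
    (aeval (fun p => (monomial (E p) 1 : MvPolynomial τ K))) (monomial m c) =
      monomial (Finsupp.weight E m) c := by
  rw [aeval_monomial, Finsupp.weight_apply, Finsupp.prod, Finsupp.sum]
  simp only [monomial_pow, one_pow]
  rw [← monomial_sum_one, algebraMap_eq, C_mul_monomial, mul_one]

/-- exponent of the image of a variable under splitting -/
noncomputable def Epsi {I : Type} (S : Set I) (p : (I × Fin 2) × Fin 2) :
    (I × Fin 2) × Fin 2 →₀ ℕ :=
  if p.1.1 ∈ S then Finsupp.single ((p.1.1, 0), p.1.2) 1 + Finsupp.single ((p.1.1, 1), p.2) 1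
  else Finsupp.single p 1

/-- splitting matrices in `S` as column times row -/
noncomputable def psi {I K : Type} [Field K] (S : Set I) : RM I K →ₐ[K] RM I K :=
  aeval (fun p => (monomial (Epsi S p) 1 : RM I K))

lemma psi_X_mem {I K : Type} [Field K] (S : Set I) (a : I) (i j : Fin 2) (ha : a ∈ S) :
    (psi S (X ((a, i), j)) : RM I K) = X ((a, 0), i) * X ((a, 1), j) := by
  rw [psi, aeval_X, Epsi, if_pos ha, X, X, monomial_mul, mul_one]

lemma psi_X_not {I K : Type} [Field K] (S : Set I) (a : I) (i j : Fin 2) (ha : a ∉ S) :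
    (psi S (X ((a, i), j)) : RM I K) = X ((a, i), j) := by
  rw [psi, aeval_X, Epsi, if_neg ha, X]

lemma weight_Epsi {I : Type} (S : Set I) (m : (I × Fin 2) × Fin 2 →₀ ℕ) (a : I) (i j : Fin 2) :
    Finsupp.weight (Epsi S) m ((a, i), j) =
      if a ∈ S then (if i = 0 then m ((a, j), 0) + m ((a, j), 1) else m ((a, 0), j) + m ((a, 1), j))
      else m ((a, i), j) := by
  induction m using Finsupp.induction_linear with
  | zero => simp
  | add f g hf hg =>
    rw [map_add, Finsupp.add_apply, hf, hg]
    split_ifs <;> simp <;> omega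
  | single v n =>
    obtain ⟨⟨b, k⟩, l⟩ := v
    rw [Finsupp.weight_single, Epsi]
    by_cases hab : b = a
    · subst hab
      by_cases hb : b ∈ S
      · simp only [hb, if_true, Finsupp.single_apply, Finsupp.smul_apply, Finsupp.add_apply,
          Prod.mk.injEq, true_and]
        fin_cases i <;> fin_cases j <;> fin_cases k <;> fin_cases l <;> simp
      · simp only [hb, if_false, Finsupp.single_apply, Finsupp.smul_apply, 
          Prod.mk.injEq, true_and]
        fin_cases i <;> fin_cases j <;> fin_cases k <;> fin_cases l <;> simp
    · by_cases hb : b ∈ S <;> by_cases ha : a ∈ S <;> simp [hb, ha, Finsupp.single_apply, hab]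

/-- normal monomials -/
def NormAt {I K : Type} [Field K] (e : I) (f : RM I K) : Prop :=
  ∀ m ∈ f.support, m ((e, 0), 0) = 0 ∨ m ((e, 1), 1) = 0

lemma psi_inj {I K : Type} [Field K] (S : Set I) (f : RM I K) (hn : ∀ e ∈ S, NormAt e f)
    (h0 : psi S f = 0) : f = 0 := by
  apply mono_inj (psi S) (Finsupp.weight (Epsi S)) (aeval_monom _) f _ h0
  intro m hm m' hm' hmm
  ext ⟨⟨a, i⟩, j⟩
  have h := fun i j => DFunLike.congr_fun hmm ((a, i), j)
  simp only [weight_Epsi] at h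
  by_cases ha : a ∈ S
  · have n1 := hn a ha m hm
    have n2 := hn a ha m' hm'
    have h00 := h 0 0
    have h01 := h 0 1
    have h10 := h 1 0
    have h11 := h 1 1
    simp only [ha, if_true] at h00 h01 h10 h11
    simp at h00 h01 h10 h11
    fin_cases i <;> fin_cases j <;> simp <;> omega
  · have := h i j
    simpa [ha] using this

lemma psi_norm {I K : Type} [Field K] (S : Set I) (e : I) (he : e ∉ S) (f : RM I K)
    (hn : NormAt e f) : NormAt e (psi S f) := by
  intro m' hm'
  obtain ⟨m, hm, rfl⟩ := mono_supp (psi S) (Finsupp.weight (Epsi S)) (aeval_monom _) f m' hm'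
  simp only [weight_Epsi, he, if_false]
  exact hn m hm

lemma psi_insert {I K : Type} [Field K] (S : Set I) (e : I) (he : e ∉ S) (f : RM I K) :
    psi (insert e S) f = psi {e} (psi S f) := by
  have : (psi (insert e S) : RM I K →ₐ[K] RM I K) = (psi {e}).comp (psi S) := by
    apply MvPolynomial.algHom_ext
    rintro ⟨⟨a, i⟩, j⟩
    rw [AlgHom.comp_apply]
    by_cases ha : a ∈ S
    · have hae : a ∉ ({e} : Set I) := by rintro rfl; exact he ha
      rw [psi_X_mem _ _ _ _ (Set.mem_insert_of_mem e ha), psi_X_mem _ _ _ _ ha, map_mul,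
        psi_X_not _ _ _ _ hae, psi_X_not _ _ _ _ hae]
    · rw [psi_X_not _ _ _ _ ha]
      by_cases hae : a = e
      · subst hae
        rw [psi_X_mem _ _ _ _ (Set.mem_insert a S), psi_X_mem _ _ _ _ (Set.mem_singleton a)]
      · rw [psi_X_not {e} _ _ _ (by simpa using hae), psi_X_not]
        simp [hae, ha]
  rw [this]; rfl

lemma psi_empty {I K : Type} [Field K] (f : RM I K) : psi ∅ f = f := by
  have : (psi ∅ : RM I K →ₐ[K] RM I K) = AlgHom.id K _ := by
    apply MvPolynomial.algHom_ext
    rintro ⟨⟨a, i⟩, j⟩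
    rw [psi_X_not _ _ _ _ (Set.notMem_empty a)]; rfl
  rw [this]; rfl

/-- determinant of a generic matrix -/
noncomputable def dt {I : Type} (K : Type) [Field K] (e : I) : RM I K :=
  X ((e, 0), 0) * X ((e, 1), 1) - X ((e, 0), 1) * X ((e, 1), 0)

lemma psi_dt_not {I K : Type} [Field K] (S : Set I) (e : I) (he : e ∉ S) :
    psi S (dt K e) = dt K e := by
  simp only [dt, map_sub, map_mul, psi_X_not _ _ _ _ he]

lemma psi_dt_mem {I K : Type} [Field K] (S : Set I) (e : I) (he : e ∈ S) :
    psi S (dt K e) = 0 := by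
  simp only [dt, map_sub, map_mul, psi_X_mem _ _ _ _ he]
  ring

lemma dt_ne {I K : Type} [Field K] (e : I) : dt K e ≠ 0 := by
  intro h0
  have := congrArg (eval (fun p : (I × Fin 2) × Fin 2 => if p = ((e, 0), 0) ∨ p = ((e, 1), 1) then (1 : K) else 0)) h0
  simp [dt] at this

/-- mixed action -/
noncomputable def actS {I V K : Type} [Field K] (s t : I → V) (S : Set I)
    (g : V → Matrix (Fin 2) (Fin 2) K) : RM I K →ₐ[K] RM I K :=
  aeval (fun p =>
    if p.1.1 ∈ S then
      (if p.1.2 = 0 then ∑ k, C (g (t p.1.1) p.2 k) * X ((p.1.1, 0), k)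
        else ∑ k, C ((g (s p.1.1)).adjugate k p.2) * X ((p.1.1, 1), k))
    else ∑ k, ∑ l, C (g (t p.1.1) p.1.2 k * (g (s p.1.1)).adjugate l p.2) * X ((p.1.1, k), l))

lemma psi_act {I V K : Type} [Field K] (s t : I → V) (S : Set I)
    (g : V → Matrix (Fin 2) (Fin 2) K) (f : RM I K) :
    psi S (actS s t ∅ g f) = actS s t S g (psi S f) := by
  have : ((psi S).comp (actS s t ∅ g) : RM I K →ₐ[K] RM I K) = (actS s t S g).comp (psi S) := by
    apply MvPolynomial.algHom_ext
    rintro ⟨⟨a, i⟩, j⟩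
    rw [AlgHom.comp_apply, AlgHom.comp_apply]
    by_cases ha : a ∈ S
    · rw [psi_X_mem _ _ _ _ ha, map_mul]
      simp only [actS, aeval_X, ha, if_true, Set.mem_empty_iff_false, if_false, map_sum, map_mul,
        psi_X_mem _ _ _ _ ha, algHom_C, Fin.sum_univ_two, algebraMap_eq]
      simp [psi_X_mem _ _ _ _ ha]
      ring
    · rw [psi_X_not _ _ _ _ ha]
      simp only [actS, aeval_X, ha, Set.mem_empty_iff_false, if_false, map_sum, map_mul,
        psi_X_not _ _ _ _ ha, algHom_C, algebraMap_eq]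
  exact congrArg (fun F => F f) this

lemma act_dt {I V K : Type} [Field K] (s t : I → V)
    (g : V → Matrix (Fin 2) (Fin 2) K) (hg : ∀ v, (g v).det = 1) (e : I) :
    actS s t ∅ g (dt K e) = dt K e := by
  have h1 := hg (t e)
  have h2 := hg (s e)
  rw [Matrix.det_fin_two] at h1 h2
  have h1' := congrArg (C : K → RM I K) h1
  have h2' := congrArg (C : K → RM I K) h2
  simp only [dt, map_sub, map_mul, actS, aeval_X, Set.mem_empty_iff_false, if_false,
    Fin.sum_univ_two, Matrix.adjugate_fin_two, C_1] at h1' h2' ⊢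
  simp at h1' h2' ⊢
  linear_combination (X ((e, 0), 0) * X ((e, 1), 1) - X ((e, 0), 1) * X ((e, 1), 0)) *
    (C (g (t e) 0 0) * C (g (t e) 1 1) - C (g (t e) 0 1) * C (g (t e) 1 0)) * h2' +
    (X ((e, 0), 0) * X ((e, 1), 1) - X ((e, 0), 1) * X ((e, 1), 0)) * h1'

end QFFT

namespace QFFT
open MvPolynomial

/-- bracket coordinates -/
noncomputable def cV (I K : Type) [Field K] (h : I × Fin 2) (i : Fin 2) : RM I K :=
  if h.2 = 0 then X (h, i) else if i = 0 then X (h, 1) else - X (h, 0)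

/-- dualization -/
noncomputable def kap (I K : Type) [Field K] : RM I K →ₐ[K] RM I K :=
  aeval (fun p => if p.1.2 = 0 then X p else if p.2 = 0 then - X (p.1, 1) else X (p.1, 0))

/-- inverse dualization -/
noncomputable def kapi (I K : Type) [Field K] : RM I K →ₐ[K] RM I K :=
  aeval (fun p => cV I K p.1 p.2)

lemma kapi_X {I K : Type} [Field K] (h : I × Fin 2) (i : Fin 2) :
    kapi I K (X (h, i)) = cV I K h i := by
  simp [kapi]

lemma kap_cV {I K : Type} [Field K] (h : I × Fin 2) (i : Fin 2) :
    kap I K (cV I K h i) = X (h, i) := by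
  obtain ⟨a, k⟩ := h
  fin_cases k <;> fin_cases i <;> simp [kap, cV]

lemma kapi_kap {I K : Type} [Field K] (f : RM I K) : kapi I K (kap I K f) = f := by
  have : (kapi I K).comp (kap I K) = AlgHom.id K _ := by
    apply MvPolynomial.algHom_ext
    rintro ⟨⟨a, k⟩, i⟩
    fin_cases k <;> fin_cases i <;> simp [kap, kapi, cV]
  exact congrArg (fun F => F f) this

/-- vertex of a half edge -/
noncomputable def vH {I V : Type} (s t : I → V) (h : I × Fin 2) : V := if h.2 = 0 then t h.1 else s h.1

lemma kap_act {I V K : Type} [Field K] (s t : I → V)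
    (g : V → Matrix (Fin 2) (Fin 2) K) (f : RM I K) :
    kap I K (actS s t Set.univ g f) = actH (vH s t) g (kap I K f) := by
  have : (kap I K).comp (actS s t Set.univ g) = (actH (vH s t) g).comp (kap I K) := by
    apply MvPolynomial.algHom_ext
    rintro ⟨⟨a, k⟩, i⟩
    fin_cases k <;> fin_cases i <;>
      simp [kap, actS, actH, vH, Matrix.adjugate_fin_two] <;> ring
  exact congrArg (fun F => F f) this

/-- arrow weight -/
def wA (I : Type) : (I × Fin 2) × Fin 2 → Multiset I := fun p => {p.1.1}

lemma count_wA {I : Type} (m : (I × Fin 2) × Fin 2 →₀ ℕ) (a : I) :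
    Multiset.count a (Finsupp.weight (wA I) m) =
      m ((a, 0), 0) + m ((a, 0), 1) + m ((a, 1), 0) + m ((a, 1), 1) := by
  induction m using Finsupp.induction_linear with
  | zero => simp
  | add f g hf hg => rw [map_add, Multiset.count_add, hf, hg]; simp; omega
  | single v n =>
    obtain ⟨⟨h', i⟩, j⟩ := v
    rw [Finsupp.weight_single, wA, Multiset.count_nsmul, Multiset.count_singleton]
    simp only [Finsupp.single_apply, Prod.mk.injEq]
    by_cases e : a = h'
    · subst e
      fin_cases i <;> fin_cases j <;> simp
    · have e' : ¬ h' = a := fun x => e x.symm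
      simp [e, e']

lemma actS_wA {I V K : Type} [Field K] (s t : I → V)
    (g : V → Matrix (Fin 2) (Fin 2) K) (f : RM I K) (α : Multiset I)
    (hf : IsWeightedHomogeneous (wA I) f α) :
    IsWeightedHomogeneous (wA I) (actS s t ∅ g f) α := by
  refine wh_aeval (wA I) (wA I) (AddMonoidHom.id _) _ ?_ f α hf
  rintro ⟨⟨a, i⟩, j⟩
  simp only [Set.mem_empty_iff_false, if_false]
  apply IsWeightedHomogeneous.sum
  intro k _
  apply IsWeightedHomogeneous.sum
  intro l _
  exact (isWeightedHomogeneous_X K (wA I) ((a, k), l)).C_mul _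

lemma ml_norm {I K : Type} [Field K] [Fintype I] (F : RM I K)
    (hF : IsWeightedHomogeneous (wA I) F Finset.univ.val) (e : I) : NormAt e F := by
  intro m hm
  have h1 := count_wA m e
  rw [hF (mem_support_iff.mp hm)] at h1
  have h2 : Multiset.count e (Finset.univ : Finset I).val ≤ 1 :=
    Multiset.nodup_iff_count_le_one.mp Finset.univ.nodup e
  omega

lemma ml_inj {I K : Type} [Field K] [Fintype I] (F : RM I K)
    (hF : IsWeightedHomogeneous (wA I) F Finset.univ.val) (h0 : psi Set.univ F = 0) : F = 0 :=
  psi_inj Set.univ F (fun e _ => ml_norm F hF e) h0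

lemma coe_eq_univ {H : Type} [Fintype H] (l : List H) :
    (l : Multiset H) = Finset.univ.val ↔ l.Nodup ∧ ∀ h, h ∈ l := by
  constructor
  · intro h
    have h1 : (l : Multiset H).Nodup := by rw [h]; exact Finset.univ.nodup
    refine ⟨Multiset.coe_nodup.mp h1, fun x => ?_⟩
    rw [← Multiset.mem_coe, h]
    exact Finset.mem_univ x
  · rintro ⟨h1, h2⟩
    rw [Multiset.Nodup.ext (Multiset.coe_nodup.mpr h1) Finset.univ.nodup]
    intro a
    simp [h2 a]

lemma count_univ_val {H : Type} [Fintype H] (h : H) :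
    Multiset.count h (Finset.univ : Finset H).val = 1 :=
  Multiset.count_univ h

lemma ml_surj_mono {I K : Type} [Field K] [Fintype I] (m : (I × Fin 2) × Fin 2 →₀ ℕ)
    (hm : Finsupp.weight (wH (I × Fin 2)) m = Finset.univ.val) :
    ∃ F : RM I K, IsWeightedHomogeneous (wA I) F Finset.univ.val ∧
      psi Set.univ F = monomial m 1 := by
  have hc : ∀ h : I × Fin 2, m (h, 0) + m (h, 1) = 1 := by
    intro h
    rw [← count_wH, hm]
    exact count_univ_val h
  refine ⟨∏ k : I, X ((k, if m ((k, 0), 0) = 1 then 0 else 1), if m ((k, 1), 0) = 1 then 0 else 1),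
    ?_, ?_⟩
  · have := IsWeightedHomogeneous.prod (w := wA I) (Finset.univ : Finset I)
      (fun k => (X ((k, if m ((k, 0), 0) = 1 then 0 else 1), if m ((k, 1), 0) = 1 then 0 else 1) : RM I K))
      (fun k => {k}) (fun k _ => isWeightedHomogeneous_X K (wA I) _)
    have e : (∑ k : I, ({k} : Multiset I)) = Finset.univ.val := by
      rw [Finset.sum_multiset_singleton]
    rw [e] at this
    exact this
  · rw [map_prod, monomial_eq, Finsupp.prod_fintype _ _ (by simp), C_1, one_mul,
      Fintype.prod_prod_type, Fintype.prod_prod_type]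
    apply Finset.prod_congr rfl
    intro k _
    rw [psi_X_mem _ _ _ _ (Set.mem_univ k)]
    simp only [Fin.prod_univ_two]
    have h0 := hc (k, 0)
    have h1 := hc (k, 1)
    congr 1
    · split_ifs with h
      · have : m ((k, 0), 1) = 0 := by omega
        rw [h, this]; simp
      · have h2 : m ((k, 0), 0) = 0 := by omega
        have h3 : m ((k, 0), 1) = 1 := by omega
        rw [h2, h3]; simp
    · split_ifs with h
      · have : m ((k, 1), 1) = 0 := by omega
        rw [h, this]; simp
      · have h2 : m ((k, 1), 0) = 0 := by omega
        have h3 : m ((k, 1), 1) = 1 := by omega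
        rw [h2, h3]; simp

lemma ml_surj {I K : Type} [Field K] [Fintype I] (y : RM I K)
    (hy : IsWeightedHomogeneous (wH (I × Fin 2)) y Finset.univ.val) :
    ∃ F : RM I K, IsWeightedHomogeneous (wA I) F Finset.univ.val ∧ psi Set.univ F = y := by
  have : ∀ m : (I × Fin 2) × Fin 2 →₀ ℕ, ∃ F : RM I K, m ∈ y.support →
      IsWeightedHomogeneous (wA I) F Finset.univ.val ∧ psi Set.univ F = monomial m 1 := by
    intro m
    by_cases hm : m ∈ y.support
    · obtain ⟨F, hF⟩ := ml_surj_mono (K := K) m (hy (mem_support_iff.mp hm))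
      exact ⟨F, fun _ => hF⟩
    · exact ⟨0, fun h => absurd h hm⟩
  choose F hF using this
  refine ⟨∑ m ∈ y.support, C (coeff m y) * F m, ?_, ?_⟩
  · apply IsWeightedHomogeneous.sum
    intro m hm
    exact (hF m hm).1.C_mul _
  · conv_rhs => rw [y.as_sum]
    rw [map_sum]
    apply Finset.sum_congr rfl
    intro m hm
    rw [map_mul, (hF m hm).2, algHom_C, algebraMap_eq, C_mul_monomial, mul_one]

lemma cV_to_X {I V K : Type} [Field K] (s t : I → V) (α : Multiset (I × Fin 2)) (y : RM I K)
    (hy : y ∈ BS (K := K) (vH s t) (cV I K) α) :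
    kap I K y ∈ BS (K := K) (vH s t) (fun h i => X (h, i)) α := by
  have : BS (K := K) (vH s t) (cV I K) α ≤
      (BS (K := K) (vH s t) (fun h i => (X (h, i) : RM I K)) α).comap (kap I K).toLinearMap := by
    apply Submodule.span_le.mpr
    rintro y ⟨l, hl, rfl⟩
    apply Submodule.subset_span
    refine ⟨l, hl, ?_⟩
    have := br_hom (vH s t) (cV I K) (kap I K : RM I K →+* RM I K) l
    simp only [RingHom.coe_coe, kap_cV] at this
    exact this
  exact this hy

lemma kap_wh {I K : Type} [Field K] (α : Multiset (I × Fin 2)) (y : RM I K)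
    (hy : IsWeightedHomogeneous (wH (I × Fin 2)) y α) :
    IsWeightedHomogeneous (wH (I × Fin 2)) (kap I K y) α := by
  refine wh_aeval (wH _) (wH _) (AddMonoidHom.id _) _ ?_ y α hy
  rintro ⟨⟨a, i⟩, j⟩
  have hX := fun j => isWeightedHomogeneous_X K (wH (I × Fin 2)) ((a, i), j)
  have hX' : IsWeightedHomogeneous (wH (I × Fin 2)) (- X ((a, i), 1) : RM I K) {(a, i)} := by
    have := (hX 1).C_mul (-1)
    simpa [wH] using this
  simp only
  split_ifs
  · exact hX j
  · exact hX'
  · exact hX 0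

lemma kapi_wh {I K : Type} [Field K] (α : Multiset (I × Fin 2)) (y : RM I K)
    (hy : IsWeightedHomogeneous (wH (I × Fin 2)) y α) :
    IsWeightedHomogeneous (wH (I × Fin 2)) (kapi I K y) α := by
  refine wh_aeval (wH _) (wH _) (AddMonoidHom.id _) _ ?_ y α hy
  rintro ⟨⟨a, i⟩, j⟩
  have hX := fun j => isWeightedHomogeneous_X K (wH (I × Fin 2)) ((a, i), j)
  have hX' : IsWeightedHomogeneous (wH (I × Fin 2)) (- X ((a, i), 0) : RM I K) {(a, i)} := by
    have := (hX 0).C_mul (-1)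
    simpa [wH] using this
  simp only [cV]
  split_ifs
  · exact hX j
  · exact hX 1
  · exact hX'

lemma BSc_wh {I V K : Type} [Field K] (s t : I → V) (α : Multiset (I × Fin 2)) (y : RM I K)
    (hy : y ∈ BS (K := K) (vH s t) (cV I K) α) :
    IsWeightedHomogeneous (wH (I × Fin 2)) y α := by
  have := kapi_wh α _ (BS_wh (vH s t) α _ (cV_to_X s t α y hy))
  rwa [kapi_kap] at this

/-- multilinear invariants -/
def MLI {I V K : Type} [Field K] [Fintype I] (s t : I → V) (F : RM I K) : Prop :=
  IsWeightedHomogeneous (wA I) F Finset.univ.val ∧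
    psi Set.univ F ∈ BS (K := K) (vH s t) (cV I K) (Finset.univ : Finset (I × Fin 2)).val

lemma MLI_inv {I V K : Type} [Field K] [Fintype I] (s t : I → V) (F : RM I K) (hF : MLI s t F)
    (g : V → Matrix (Fin 2) (Fin 2) K) (hg : ∀ v, (g v).det = 1) : actS s t ∅ g F = F := by
  rw [← sub_eq_zero]
  apply ml_inj _ ((actS_wA s t g F _ hF.1).sub hF.1)
  rw [map_sub, psi_act, sub_eq_zero]
  have h1 := BS_inv _ _ _ (cV_to_X s t _ _ hF.2) g hg
  rw [← kap_act] at h1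
  have := congrArg (kapi I K) h1
  rwa [kapi_kap, kapi_kap] at this

/-- rename arrows -/
def rnm {I A : Type} (e : I → A) (p : (I × Fin 2) × Fin 2) : (A × Fin 2) × Fin 2 :=
  ((e p.1.1, p.1.2), p.2)

/-- span of restitutions of multilinear invariants -/
noncomputable def TT {A V : Type} (K : Type) [Field K] (s t : A → V) (α : Multiset A) :
    Submodule K (RM A K) :=
  Submodule.span K {x | ∃ (I : Type) (_ : Fintype I) (e : I → A) (F : RM I K),
    Finset.univ.val.map e = α ∧ MLI (fun k => s (e k)) (fun k => t (e k)) F ∧ x = rename (rnm e) F}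

lemma TT_wh {A V K : Type} [Field K] (s t : A → V) (α : Multiset A) (x : RM A K)
    (hx : x ∈ TT K s t α) : IsWeightedHomogeneous (wA A) x α := by
  rw [← mem_weightedHomogeneousSubmodule]
  refine Submodule.span_le.mpr ?_ hx
  rintro x ⟨I, _, e, F, rfl, hF, rfl⟩
  rw [rename_eq_aeval]
  exact wh_aeval (wA I) (wA A) (Multiset.mapAddMonoidHom e) _
    (fun v => isWeightedHomogeneous_X K (wA A) (rnm e v)) F _ hF.1

lemma rnm_act {A I V K : Type} [Field K] (s t : A → V) (e : I → A)
    (g : V → Matrix (Fin 2) (Fin 2) K) (F : RM I K) :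
    actS s t ∅ g (rename (rnm e) F) =
      rename (rnm e) (actS (fun k => s (e k)) (fun k => t (e k)) ∅ g F) := by
  have : (actS s t ∅ g).comp (rename (rnm e)) =
      (rename (rnm e)).comp (actS (fun k => s (e k)) (fun k => t (e k)) ∅ g) := by
    apply MvPolynomial.algHom_ext
    intro p
    simp [actS, rnm]
  exact congrArg (fun G => G F) this

lemma TT_inv {A V K : Type} [Field K] (s t : A → V) (α : Multiset A) (x : RM A K)
    (hx : x ∈ TT K s t α) (g : V → Matrix (Fin 2) (Fin 2) K) (hg : ∀ v, (g v).det = 1) :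
    actS s t ∅ g x = x := by
  induction hx using Submodule.span_induction with
  | mem x hx =>
    obtain ⟨I, _, e, F, rfl, hF, rfl⟩ := hx
    rw [rnm_act, MLI_inv _ _ F hF g hg]
  | zero => simp
  | add x y _ _ hx hy => rw [map_add, hx, hy]
  | smul a x _ hx => rw [map_smul, hx]

end QFFT

namespace QFFT
open MvPolynomial

lemma psi_rnm {A I K : Type} [Field K] (e : I → A) (F : RM I K) :
    psi Set.univ (rename (rnm e) F) = rename (rnm e) (psi Set.univ F) := by
  have : (psi Set.univ).comp (rename (rnm e)) =
      (rename (rnm e) : RM I K →ₐ[K] RM A K).comp (psi Set.univ) := by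
    apply MvPolynomial.algHom_ext
    rintro ⟨⟨a, i⟩, j⟩
    rw [AlgHom.comp_apply, AlgHom.comp_apply, rename_X, psi_X_mem _ _ _ _ (Set.mem_univ a)]
    simp only [rnm]
    rw [psi_X_mem _ _ _ _ (Set.mem_univ (e a))]
    simp [rnm]
  exact congrArg (fun G => G F) this

lemma rnm_cV {A I K : Type} [Field K] (e : I → A) (h : I × Fin 2) (i : Fin 2) :
    rename (rnm e) (cV I K h i) = cV A K (e h.1, h.2) i := by
  simp only [cV]
  split_ifs <;> simp [rnm]

/-- polarized determinant -/
noncomputable def pdt {I : Type} (K : Type) [Field K] (p q : I) : RM I K :=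
  X ((p, 0), 0) * X ((q, 1), 1) + X ((p, 1), 1) * X ((q, 0), 0)
    - X ((p, 0), 1) * X ((q, 1), 0) - X ((p, 1), 0) * X ((q, 0), 1)

lemma pdt_wh {I K : Type} [Field K] (p q : I) :
    IsWeightedHomogeneous (wA I) (pdt K p q) ({p} + {q}) := by
  have h := fun i j k l => (isWeightedHomogeneous_X K (wA I) ((p, i), j)).mul
    (isWeightedHomogeneous_X K (wA I) ((q, k), l))
  exact (((h 0 0 1 1).add (h 1 1 0 0)).sub (h 0 1 1 0)).sub (h 1 0 0 1)

lemma MLI_pdt {I V K : Type} [Field K] [Fintype I] (s t : I ⊕ Fin 2 → V) (F : RM I K)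
    (hs : s (Sum.inr 0) = s (Sum.inr 1)) (ht : t (Sum.inr 0) = t (Sum.inr 1))
    (hF : MLI (fun k => s (Sum.inl k)) (fun k => t (Sum.inl k)) F) :
    MLI s t (pdt K (Sum.inr 0) (Sum.inr 1) * rename (rnm Sum.inl) F) := by
  constructor
  · have h1 : IsWeightedHomogeneous (wA (I ⊕ Fin 2)) (rename (rnm Sum.inl) F)
        (Finset.univ.val.map Sum.inl) := by
      rw [rename_eq_aeval]
      exact wh_aeval (wA I) (wA _) (Multiset.mapAddMonoidHom Sum.inl) _
        (fun v => isWeightedHomogeneous_X K (wA _) (rnm Sum.inl v)) F _ hF.1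
    have h2 := (pdt_wh (K := K) (Sum.inr 0 : I ⊕ Fin 2) (Sum.inr 1)).mul h1
    convert h2 using 1
    symm
    rw [Multiset.Nodup.ext _ Finset.univ.nodup]
    · rintro (a | a)
      · simp
      · fin_cases a <;> simp
    · rw [add_assoc, Multiset.singleton_add, Multiset.singleton_add, Multiset.nodup_cons,
        Multiset.nodup_cons]
      simp
      exact Multiset.Nodup.map Sum.inl_injective Finset.univ.nodup
  · rw [map_mul, psi_rnm]
    have : BS (K := K) (vH (fun k => s (Sum.inl k)) (fun k => t (Sum.inl k))) (cV I K) Finset.univ.val ≤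
      (BS (K := K) (vH s t) (cV (I ⊕ Fin 2) K) Finset.univ.val).comap
        ((LinearMap.mulLeft K (psi Set.univ (pdt K (Sum.inr 0) (Sum.inr 1)))).comp
          (rename (rnm Sum.inl) : RM I K →ₐ[K] RM (I ⊕ Fin 2) K).toLinearMap) := by
      apply Submodule.span_le.mpr
      rintro y ⟨l, hl, rfl⟩
      apply Submodule.subset_span
      rw [coe_eq_univ] at hl
      refine ⟨(Sum.inr 0, 0) :: (Sum.inr 1, 0) :: (Sum.inr 0, 1) :: (Sum.inr 1, 1) ::
        l.map (fun h => (Sum.inl h.1, h.2)), ?_, ?_⟩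
      · rw [coe_eq_univ]
        constructor
        · simp
          refine List.Nodup.map ?_ hl.1
          rintro ⟨a, i⟩ ⟨b, j⟩ h
          simpa using h
        · rintro ⟨a | a, i⟩
          · simp [hl.2]
          · fin_cases a <;> fin_cases i <;> simp
      · have e := br_hom (vH (fun k => s (Sum.inl k)) (fun k => t (Sum.inl k))) (cV I K)
          (rename (rnm Sum.inl) : RM I K →ₐ[K] RM (I ⊕ Fin 2) K).toRingHom l
        simp only [AlgHom.toRingHom_eq_coe, RingHom.coe_coe, rnm_cV] at e
        simp only [br, br_map]
        rw [LinearMap.comp_apply, LinearMap.mulLeft_apply, AlgHom.toLinearMap_apply]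
        rw [e]
        rw [if_pos (by simp [vH, ht]), if_pos (by simp [vH, hs]), ← mul_assoc]
        congr 1
        simp only [pdt, map_sub, map_add, map_mul, psi_X_mem _ _ _ _ (Set.mem_univ _)]
        simp [cV]
        ring
    exact this hF.2

lemma TT_dt {A V K : Type} [Field K] (h2 : (2 : K) ≠ 0) (s t : A → V) (β : Multiset A) (a : A)
    (x : RM A K) (hx : x ∈ TT K s t β) : dt K a * x ∈ TT K s t (β + ({a} + {a})) := by
  induction hx using Submodule.span_induction with
  | mem x hx =>
    obtain ⟨I, _, e, F, rfl, hF, rfl⟩ := hx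
    have h3 : rename (rnm (Sum.elim e (fun _ : Fin 2 => a)))
        (pdt K (Sum.inr 0) (Sum.inr 1) * rename (rnm Sum.inl) F) ∈
        TT K s t (Finset.univ.val.map e + ({a} + {a})) := by
      apply Submodule.subset_span
      refine ⟨I ⊕ Fin 2, inferInstance, Sum.elim e (fun _ : Fin 2 => a), _, ?_, ?_, rfl⟩
      · rw [← Finset.univ_disjSum_univ, Finset.val_disjSum, Multiset.disjSum, Multiset.map_add,
          Multiset.map_map, Multiset.map_map]
        rfl
      · apply MLI_pdt
        · simp
        · simp
        · simpa using hF
    have h4 := Submodule.smul_mem _ (2⁻¹ : K) h3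
    convert h4 using 1
    rw [map_mul, rename_rename]
    have e1 : (rnm (Sum.elim e (fun _ : Fin 2 => a)) ∘ rnm Sum.inl) = rnm e := by
      funext p; simp [rnm]
    rw [e1]
    have e2 : rename (rnm (Sum.elim e (fun _ : Fin 2 => a))) (pdt K (Sum.inr 0) (Sum.inr 1)) =
        (2 : K) • dt K a := by
      rw [smul_eq_C_mul, map_ofNat]
      simp [pdt, dt, rnm]
      ring
    rw [e2, smul_mul_assoc, smul_smul, inv_mul_cancel₀ h2, one_smul]
  | zero => simp
  | add x y _ _ hx hy => rw [mul_add]; exact Submodule.add_mem _ hx hy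
  | smul a x _ hx => rw [mul_smul_comm]; exact Submodule.smul_mem _ _ hx

lemma univ_half {I : Type} [Fintype I] : (Finset.univ : Finset (I × Fin 2)).val =
    Finset.univ.val.map (fun k => (k, 0)) + Finset.univ.val.map (fun k => (k, 1)) := by
  rw [Multiset.Nodup.ext Finset.univ.nodup]
  · rintro ⟨a, i⟩
    fin_cases i <;> simp
  · rw [Multiset.nodup_add]
    refine ⟨Finset.univ.nodup.map fun a b h => by simpa using h,
      Finset.univ.nodup.map fun a b h => by simpa using h, ?_⟩
    rw [Multiset.disjoint_left]
    intro a h1 h2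
    simp at h1 h2
    obtain ⟨x, rfl⟩ := h1
    simp at h2

lemma psi_wh {A K : Type} [Field K] (f : RM A K) (α : Multiset A)
    (hf : IsWeightedHomogeneous (wA A) f α) :
    IsWeightedHomogeneous (wH (A × Fin 2)) (psi Set.univ f)
      (α.map (fun k => (k, 0)) + α.map (fun k => (k, 1))) := by
  refine wh_aeval (wA A) (wH (A × Fin 2)) (Multiset.mapAddMonoidHom (fun k => (k, (0 : Fin 2))) +
    Multiset.mapAddMonoidHom (fun k => (k, (1 : Fin 2)))) _ ?_ f α hf
  rintro ⟨⟨a, i⟩, j⟩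
  have h1 := psi_X_mem (K := K) Set.univ a i j (Set.mem_univ a)
  simp only [psi, aeval_X] at h1
  rw [h1]
  have := (isWeightedHomogeneous_X K (wH (A × Fin 2)) ((a, 0), i)).mul
    (isWeightedHomogeneous_X K (wH (A × Fin 2)) ((a, 1), j))
  simpa [wA, wH] using this

lemma base_univ {A V K : Type} [Field K] [Infinite K] (s t : A → V) (α : Multiset A) (f : RM A K)
    (hf : IsWeightedHomogeneous (wA A) f α)
    (hi : ∀ g : V → Matrix (Fin 2) (Fin 2) K, (∀ v, (g v).det = 1) →
      psi Set.univ (actS s t ∅ g f) = psi Set.univ f) :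
    ∃ x ∈ TT K s t α, psi Set.univ x = psi Set.univ f := by
  have hw := kap_wh _ _ (psi_wh f α hf)
  have hinv : InvH (vH s t) (kap A K (psi Set.univ f)) := by
    intro g hg
    rw [← kap_act, ← psi_act, hi g hg]
  have hbs := fft_vec (vH s t) _ _ rfl _ hw hinv
  obtain ⟨l, rfl⟩ : ∃ l : List A, (l : Multiset A) = α := Quot.exists_rep α
  set e : Fin l.length → A := l.get with he
  have hel : Finset.univ.val.map e = (l : Multiset A) := by
    rw [Fin.univ_val_map, he, List.ofFn_get]
  have hal : ((l : Multiset A).map (fun k => (k, (0 : Fin 2))) +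
      (l : Multiset A).map (fun k => (k, 1))) =
      (Finset.univ : Finset (Fin l.length × Fin 2)).val.map (fun h => (e h.1, h.2)) := by
    rw [univ_half, Multiset.map_add, Multiset.map_map, Multiset.map_map]
    rw [← hel, Multiset.map_map, Multiset.map_map]
    rfl
  rw [hal] at hbs
  obtain ⟨y, hy, hy2⟩ := BS_lift (vH s t) (fun h : Fin l.length × Fin 2 => (e h.1, h.2)) (fun h i => X (h, i))
    (cV (Fin l.length) K) ((kap A K).comp (rename (rnm e))) (by
      intro h i
      rw [AlgHom.comp_apply, rnm_cV, kap_cV]) _ _ hbs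
  have hv : (fun h : Fin l.length × Fin 2 => vH s t (e h.1, h.2)) =
      vH (fun k => s (e k)) (fun k => t (e k)) := by
    funext h; simp [vH]
  rw [hv] at hy
  obtain ⟨F, hF1, hF2⟩ := ml_surj y (BSc_wh _ _ _ _ hy)
  refine ⟨rename (rnm e) F, Submodule.subset_span ⟨_, inferInstance, e, F, hel, ⟨hF1, ?_⟩, rfl⟩, ?_⟩
  · rw [hF2]; exact hy
  · rw [psi_rnm, hF2]
    have := congrArg (kapi A K) hy2
    rwa [AlgHom.comp_apply, kapi_kap, kapi_kap] at this

theorem fft_mat_aux {A V K : Type} [Field K] [Infinite K] [Fintype A] (h2 : (2 : K) ≠ 0) (s t : A → V)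
    (T : Finset A) : ∀ (N : ℕ) (α : Multiset A), α.card = N → ∀ f : RM A K,
    IsWeightedHomogeneous (wA A) f α →
    (∀ g : V → Matrix (Fin 2) (Fin 2) K, (∀ v, (g v).det = 1) →
      psi {a | a ∉ T} (actS s t ∅ g f) = psi {a | a ∉ T} f) →
    ∃ x ∈ TT K s t α, psi {a | a ∉ T} x = psi {a | a ∉ T} f := by
  induction T using Finset.induction_on with
  | empty =>
    intro N α _ f hf hi
    have : {a : A | a ∉ (∅ : Finset A)} = Set.univ := by ext; simp
    rw [this] at hi ⊢
    exact base_univ s t α f hf hi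
  | insert e T heT ihT =>
    have hS : {a | a ∉ T} = insert e {a | a ∉ insert e T} := by
      ext a
      by_cases h : a = e
      · subst h; simp [heT]
      · simp [h]
    have heS : e ∉ {a | a ∉ insert e T} := by simp
    set S := {a | a ∉ insert e T} with hSd
    intro N
    induction N using Nat.strong_induction_on with
    | _ N ih =>
    intro α hN f hf hi
    obtain ⟨x, hx, hxf⟩ := ihT N α hN f hf (by
      intro g hg
      rw [hS, psi_insert S e heS, psi_insert S e heS, hi g hg])
    rw [hS, psi_insert S e heS, psi_insert S e heS] at hxf
    have hxw := TT_wh s t α x hx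
    obtain ⟨q, r, e1, e2, e3, e4⟩ := nf ((e, (0 : Fin 2)), (0 : Fin 2)) ((e, 0), 1) ((e, 1), 0) ((e, 1), 1)
      (by simp) (by simp) (by simp) (wA A) rfl (f - x) α (hf.sub hxw)
    change f - x = dt K e * q + r at e1
    have hr : psi S r = 0 := by
      apply psi_inj {e}
      · intro e' he'
        rw [Set.mem_singleton_iff] at he'
        subst he'
        exact psi_norm S e' heS r e4
      · have h3 : psi {e} (psi S (f - x)) = 0 := by rw [map_sub, map_sub, hxf, sub_self]
        rwa [e1, map_add, map_mul, psi_dt_not S e heS, map_add, map_mul,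
          psi_dt_mem _ _ (Set.mem_singleton e), zero_mul, zero_add] at h3
    by_cases hq0 : q = 0
    · refine ⟨x, hx, ?_⟩
      have := congrArg (psi S) e1
      rw [hq0, mul_zero, zero_add, hr, map_sub, sub_eq_zero] at this
      exact this.symm
    obtain ⟨β, hβ, hqw⟩ := wh_of_supp (wA A) q α _ e2 hq0
    have hβ' : β + ({e} + {e}) = α := hβ
    have hcard : β.card < N := by
      rw [← hN, ← hβ']; simp
    obtain ⟨y, hy, hyq⟩ := ih _ hcard β rfl q hqw (by
      intro g hg
      have h3 : psi S (actS s t ∅ g (f - x)) = psi S (f - x) := by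
        rw [map_sub, map_sub, hi g hg, TT_inv s t α x hx g hg, map_sub]
      rw [e1, map_add, map_add, map_add, map_mul, map_mul, map_mul, psi_act s t S g r, hr, map_zero,
        add_zero, add_zero, act_dt s t g hg, psi_dt_not S e heS] at h3
      exact mul_left_cancel₀ (dt_ne e) h3)
    refine ⟨x + dt K e * y, Submodule.add_mem _ hx ?_, ?_⟩
    · rw [← hβ']; exact TT_dt h2 s t β e y hy
    · have := congrArg (psi S) e1
      rw [map_add, map_mul, hr, add_zero, map_sub] at this
      rw [map_add, map_mul, hyq, ← this]
      ring

theorem fft_mat {A V K : Type} [Field K] [Infinite K] [Fintype A] (h2 : (2 : K) ≠ 0) (s t : A → V)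
    (α : Multiset A) (f : RM A K) (hf : IsWeightedHomogeneous (wA A) f α)
    (hi : ∀ g : V → Matrix (Fin 2) (Fin 2) K, (∀ v, (g v).det = 1) → actS s t ∅ g f = f) :
    f ∈ TT K s t α := by
  obtain ⟨x, hx, h⟩ := fft_mat_aux h2 s t Finset.univ _ α rfl f hf (by
    intro g hg
    rw [hi g hg])
  have : {a : A | a ∉ Finset.univ} = ∅ := by ext; simp
  rw [this, psi_empty, psi_empty] at h
  rwa [← h]

end QFFT

namespace QFFT
open MvPolynomial

/-- number of half edges of type `i` at `v` -/
noncomputable def cnt {I V : Type} (vert : I × Fin 2 → V) (v : V) (i : Fin 2)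
    (m : Multiset (I × Fin 2)) : ℕ := Multiset.countP (fun h => vert h = v ∧ h.2 = i) m

lemma cnt_cons {I V : Type} (vert : I × Fin 2 → V) (v : V) (i : Fin 2)
    (m : Multiset (I × Fin 2)) (a : I × Fin 2) :
    cnt vert v i (a ::ₘ m) = cnt vert v i m + if vert a = v ∧ a.2 = i then 1 else 0 := by
  rw [cnt, Multiset.countP_cons]; rfl

lemma cnt_add {I V : Type} (vert : I × Fin 2 → V) (v : V) (i : Fin 2)
    (m m' : Multiset (I × Fin 2)) : cnt vert v i (m + m') = cnt vert v i m + cnt vert v i m' := by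
  rw [cnt, Multiset.countP_add]; rfl

lemma cnt_map {I J V : Type} (vert : I × Fin 2 → V) (v : V) (i : Fin 2)
    (m : Multiset J) (f : J → I × Fin 2) :
    cnt vert v i (m.map f) = (m.filter (fun a => vert (f a) = v ∧ (f a).2 = i)).card := by
  induction m using Multiset.induction with
  | empty => simp [cnt]
  | cons a m ih =>
    rw [Multiset.map_cons, cnt_cons, ih, Multiset.filter_cons]
    split_ifs <;> simp [add_comm]

/-- bracket -/
def bk {H R : Type} [CommRing R] (c : H → Fin 2 → R) (a b : H) : R :=
  c a 0 * c b 1 - c a 1 * c b 0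

lemma find_pair {I V R : Type} [CommRing R] (vert : I × Fin 2 → V) (c : I × Fin 2 → Fin 2 → R)
    (v : V) (i j : Fin 2) (hij : i ≠ j) : ∀ l : List (I × Fin 2), cnt vert v j l < cnt vert v i l →
    br vert c l = 0 ∨ ∃ a b l2, vert a = v ∧ vert b = v ∧ a.2 = i ∧ b.2 = i ∧
      br vert c l = bk c a b * br vert c l2 ∧ (l : Multiset (I × Fin 2)) = a ::ₘ b ::ₘ l2
  | [] => fun h => by simp [cnt] at h
  | [_] => fun _ => Or.inl (by simp [br])
  | a :: b :: l => fun h => by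
    rw [← Multiset.cons_coe, ← Multiset.cons_coe, cnt_cons, cnt_cons, cnt_cons, cnt_cons] at h
    by_cases hab : vert a = vert b
    · by_cases hdone : vert a = v ∧ a.2 = i ∧ b.2 = i
      · right
        exact ⟨a, b, l, hdone.1, hab ▸ hdone.1, hdone.2.1, hdone.2.2, by simp [br, hab, bk], rfl⟩
      · have h' : cnt vert v j l < cnt vert v i l := by
          by_cases hv : vert a = v
          · have hv' : vert b = v := hab ▸ hv
            simp only [hv, hv', true_and] at h hdone
            have ha : a.2 = i ∨ a.2 = j := by
              generalize a.2 = x at *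
              fin_cases x <;> fin_cases i <;> fin_cases j <;> simp_all
            have hb : b.2 = i ∨ b.2 = j := by
              generalize b.2 = x at *
              fin_cases x <;> fin_cases i <;> fin_cases j <;> simp_all
            rcases ha with ha | ha <;> rcases hb with hb | hb <;>
              simp [ha, hb, hij, hij.symm] at h hdone <;> omega
          · have hv' : ¬ vert b = v := hab ▸ hv
            simpa [hv, hv'] using h
        rcases find_pair vert c v i j hij l h' with h0 | ⟨x, y, l2, e1, e2, e3, e4, e5, e6⟩
        · left; rw [br, h0, mul_zero]
        · right
          refine ⟨x, y, a :: b :: l2, e1, e2, e3, e4, ?_, ?_⟩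
          · rw [br, e5, br]; ring
          · rw [← Multiset.cons_coe, ← Multiset.cons_coe, e6, ← Multiset.cons_coe,
              ← Multiset.cons_coe]
            rw [Multiset.cons_swap b x, Multiset.cons_swap a x, Multiset.cons_swap b y,
              Multiset.cons_swap a y]
    · left; simp [br, hab]

/-- span of mixed words -/
noncomputable def MS {I V K R : Type} [Field K] [CommRing R] [Algebra K R] (vert : I × Fin 2 → V)
    (c : I × Fin 2 → Fin 2 → R) (α : Multiset (I × Fin 2)) : Submodule K R :=
  Submodule.span K {x | ∃ L : List (I × I), (∀ p ∈ L, vert (p.1, 1) = vert (p.2, 0)) ∧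
    ((L.map (fun p => (p.1, (1 : Fin 2))) ++ L.map (fun p => (p.2, (0 : Fin 2))) :
      List (I × Fin 2)) : Multiset (I × Fin 2)) = α ∧
    x = (L.map (fun p => bk c (p.1, 1) (p.2, 0))).prod}

lemma MS_mul {I V K R : Type} [Field K] [CommRing R] [Algebra K R] (vert : I × Fin 2 → V)
    (c : I × Fin 2 → Fin 2 → R) (α : Multiset (I × Fin 2)) (x : R)
    (hx : x ∈ MS (K := K) vert c α) (a b : I × Fin 2) (hab : vert a = vert b) (ha : a.2 = 1)
    (hb : b.2 = 0) : bk c a b * x ∈ MS (K := K) vert c (a ::ₘ b ::ₘ α) := by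
  obtain ⟨a, _⟩ := a
  obtain ⟨b, _⟩ := b
  simp only at ha hb
  subst ha hb
  induction hx using Submodule.span_induction with
  | mem x hx =>
    obtain ⟨L, h1, rfl, rfl⟩ := hx
    apply Submodule.subset_span
    refine ⟨(a, b) :: L, ?_, ?_, by simp⟩
    · intro p hp
      rcases List.mem_cons.mp hp with rfl | hp
      · exact hab
      · exact h1 p hp
    · simp only [List.map_cons, List.cons_append, ← Multiset.cons_coe]
      congr 1
      rw [Multiset.cons_coe, Multiset.coe_eq_coe]
      exact List.perm_middle
  | zero => simp
  | add x y _ _ hx hy => rw [mul_add]; exact Submodule.add_mem _ hx hy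
  | smul k x _ hx => rw [mul_smul_comm]; exact Submodule.smul_mem _ _ hx

lemma br_mixed {I V K R : Type} [Field K] [CommRing R] [Algebra K R] (vert : I × Fin 2 → V)
    (c : I × Fin 2 → Fin 2 → R) : ∀ (N : ℕ) (l : List (I × Fin 2)), l.length = N →
    (∀ v, cnt vert v 0 l = cnt vert v 1 l) → br vert c l ∈ MS (K := K) vert c l := by
  intro N
  induction N using Nat.strong_induction_on with
  | _ N ih =>
  intro l hN hbal
  match l, hN, hbal with
  | [], _, _ => exact Submodule.subset_span ⟨[], by simp, by simp, by simp [br]⟩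
  | [_], _, _ => rw [br]; exact Submodule.zero_mem _
  | a :: b :: l, hN, hbal =>
    by_cases hab : vert a = vert b
    swap
    · simp [br, hab]
    have hbr : br vert c (a :: b :: l) = bk c a b * br vert c l := by simp [br, hab, bk]
    have hN' : l.length + 2 = N := by simpa using hN
    simp only [← Multiset.cons_coe, cnt_cons] at hbal
    rw [hbr, ← Multiset.cons_coe, ← Multiset.cons_coe]
    have f2 : ∀ x : Fin 2, x = 0 ∨ x = 1 := by decide
    rcases f2 a.2 with ha | ha <;> rcases f2 b.2 with hb | hb
    · -- two heads
      have h1 := hbal (vert a)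
      simp [ha, hb, hab] at h1
      rcases find_pair vert c (vert a) 1 0 (by simp) l (by rw [hab]; omega) with
        h0 | ⟨x, y, l2, e1, e2, e3, e4, e5, e6⟩
      · rw [h0, mul_zero]; exact Submodule.zero_mem _
      · have hl2 : l2.length < N := by
          have := congrArg Multiset.card e6
          simp at this
          omega
        have h3 := ih _ hl2 l2 rfl (by
          intro v
          have := hbal v
          rw [e6] at this
          simp only [cnt_cons, ha, hb, e1, e2, e3, e4, hab] at this
          by_cases hv : vert b = v <;> simp [hv] at this <;> omega)
        have h4 := MS_mul vert c _ _ (MS_mul vert c _ _ h3 y b (by rw [e2, hab]) e4 hb) x a e1 e3 ha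
        have h5 := MS_mul vert c _ _ (MS_mul vert c _ _ h3 y a e2 e4 ha) x b (by rw [e1, hab]) e3 hb
        rw [e5, e6]
        have e7 : x ::ₘ a ::ₘ y ::ₘ b ::ₘ (l2 : Multiset (I × Fin 2)) = a ::ₘ b ::ₘ x ::ₘ y ::ₘ l2 := by
          rw [Multiset.cons_swap y b, Multiset.cons_swap x a, Multiset.cons_swap x b]
        have e8 : x ::ₘ b ::ₘ y ::ₘ a ::ₘ (l2 : Multiset (I × Fin 2)) = a ::ₘ b ::ₘ x ::ₘ y ::ₘ l2 := by
          rw [Multiset.cons_swap y a, Multiset.cons_swap b a, Multiset.cons_swap x a,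
            Multiset.cons_swap x b]
        rw [e7] at h4
        rw [e8] at h5
        have h6 := Submodule.sub_mem _ h4 h5
        convert h6 using 1
        simp only [bk]
        ring
    · -- head, tail
      have h3 := ih _ (by omega) l rfl (by
          intro v
          have := hbal v
          simp only [ha, hb, hab] at this
          by_cases hv : vert b = v <;> simp [hv] at this <;> omega)
      have h4 := Submodule.neg_mem _ (MS_mul vert c _ _ h3 b a hab.symm hb ha)
      rw [Multiset.cons_swap] at h4
      convert h4 using 1
      simp only [bk]
      ring
    · -- tail, head
      have h3 := ih _ (by omega) l rfl (by
          intro v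
          have := hbal v
          simp only [ha, hb, hab] at this
          by_cases hv : vert b = v <;> simp [hv] at this <;> omega)
      exact MS_mul vert c _ _ h3 a b hab ha hb
    · -- two tails
      have h1 := hbal (vert a)
      simp [ha, hb, hab] at h1
      rcases find_pair vert c (vert a) 0 1 (by simp) l (by rw [hab]; omega) with
        h0 | ⟨x, y, l2, e1, e2, e3, e4, e5, e6⟩
      · rw [h0, mul_zero]; exact Submodule.zero_mem _
      · have hl2 : l2.length < N := by
          have := congrArg Multiset.card e6
          simp at this
          omega
        have h3 := ih _ hl2 l2 rfl (by
          intro v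
          have := hbal v
          rw [e6] at this
          simp only [cnt_cons, ha, hb, e1, e2, e3, e4, hab] at this
          by_cases hv : vert b = v <;> simp [hv] at this <;> omega)
        have h4 := MS_mul vert c _ _ (MS_mul vert c _ _ h3 b y (by rw [e2, hab]) hb e4) a x e1.symm ha e3
        have h5 := MS_mul vert c _ _ (MS_mul vert c _ _ h3 b x (by rw [e1, hab]) hb e3) a y e2.symm ha e4
        rw [e5, e6]
        have e7 : a ::ₘ x ::ₘ b ::ₘ y ::ₘ (l2 : Multiset (I × Fin 2)) = a ::ₘ b ::ₘ x ::ₘ y ::ₘ l2 := by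
          rw [Multiset.cons_swap x b]
        have e8 : a ::ₘ y ::ₘ b ::ₘ x ::ₘ (l2 : Multiset (I × Fin 2)) = a ::ₘ b ::ₘ x ::ₘ y ::ₘ l2 := by
          rw [Multiset.cons_swap y b, Multiset.cons_swap y x]
        rw [e7] at h4
        rw [e8] at h5
        have h6 := Submodule.sub_mem _ h4 h5
        convert h6 using 1
        simp only [bk]
        ring

/-- contraction of matrices along a permutation -/
noncomputable def TG {I R : Type} [Fintype I] [CommRing R] (M : I → Matrix (Fin 2) (Fin 2) R)
    (τ : Equiv.Perm I) : R := ∑ i : I → Fin 2, ∏ k, M k (i k) (i (τ k))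

/-- generic matrices -/
noncomputable def gM {I : Type} (K : Type) [Field K] (k : I) : Matrix (Fin 2) (Fin 2) (RM I K) :=
  fun i j => X ((k, i), j)

lemma TG_wh {I K : Type} [Field K] [Fintype I] (τ : Equiv.Perm I) :
    IsWeightedHomogeneous (wA I) (TG (gM (I := I) K) τ) Finset.univ.val := by
  apply IsWeightedHomogeneous.sum
  intro i _
  have := IsWeightedHomogeneous.prod (w := wA I) (Finset.univ : Finset I)
      (fun k => (gM K k (i k) (i (τ k)) : RM I K))
      (fun k => {k}) (fun k _ => isWeightedHomogeneous_X K (wA I) ((k, i k), i (τ k)))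
  have e : (∑ k : I, ({k} : Multiset I)) = Finset.univ.val := by
    rw [Finset.sum_multiset_singleton]
  rw [e] at this
  exact this

lemma psi_TG {I K : Type} [Field K] [Fintype I] (τ : Equiv.Perm I) :
    psi Set.univ (TG (gM (I := I) K) τ) = ∏ k, bk (cV I K) (k, 1) (τ k, 0) := by
  have h1 : ∀ k, bk (cV I K) (k, 1) (τ k, 0) = ∑ j : Fin 2, X ((k, 1), j) * X ((τ k, 0), j) := by
    intro k
    simp [bk, cV]
    ring
  simp only [h1]
  rw [Finset.prod_univ_sum, TG, map_sum, Fintype.piFinset_univ]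
  symm
  apply Finset.sum_bij (fun (j : I → Fin 2) _ => (fun k => j (τ.symm k)))
  · intro a _; simp
  · intro a _ b _ h
    funext k
    have := congrFun h (τ k)
    simpa using this
  · intro b _
    refine ⟨fun k => b (τ k), by simp, ?_⟩
    funext k
    simp
  · intro j _
    rw [map_prod]
    simp only [gM, psi_X_mem _ _ _ _ (Set.mem_univ _), Finset.prod_mul_distrib]
    rw [mul_comm]
    congr 1
    · rw [← Equiv.prod_comp τ (fun k => (X ((k, 0), j (τ.symm k)) : RM I K))]
      simp
    · simp

lemma MS_perm {I V K : Type} [Field K] [Fintype I] (s t : I → V) (y : RM I K)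
    (hy : y ∈ MS (K := K) (vH s t) (cV I K) (Finset.univ : Finset (I × Fin 2)).val) :
    ∃ G ∈ Submodule.span K {x | ∃ τ : Equiv.Perm I, (∀ k, s k = t (τ k)) ∧
      x = TG (gM (I := I) K) τ}, psi Set.univ G = y := by
  have : MS (K := K) (vH s t) (cV I K) (Finset.univ : Finset (I × Fin 2)).val ≤
    (Submodule.span K {x | ∃ τ : Equiv.Perm I, (∀ k, s k = t (τ k)) ∧
      x = TG (gM (I := I) K) τ}).map (psi Set.univ).toLinearMap := by
    apply Submodule.span_le.mpr
    rintro y ⟨L, hL, hc, rfl⟩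
    rw [coe_eq_univ] at hc
    obtain ⟨hnd, hmem⟩ := hc
    have hn1 : (L.map (fun p => (p.1, (1 : Fin 2)))).Nodup := (List.nodup_append.mp hnd).1
    have hn2 : (L.map (fun p => (p.1))).Nodup := by
      apply List.Nodup.of_map (fun k => (k, (1 : Fin 2)))
      simpa [List.map_map, Function.comp_def] using hn1
    have hm1 : ∀ k, ∃ k', (k, k') ∈ L := by
      intro k
      have := hmem (k, 1)
      simpa using this
    have hm2 : ∀ k, ∃ k', (k', k) ∈ L := by
      intro k
      have := hmem (k, 0)
      simpa using this
    choose f hf using hm1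
    have hinj := List.inj_on_of_nodup_map hn2
    have hfs : Function.Surjective f := by
      intro k
      obtain ⟨k', hk'⟩ := hm2 k
      refine ⟨k', ?_⟩
      have := hinj (hf k') hk' rfl
      exact congrArg Prod.snd this
    have hfb : Function.Bijective f := ⟨Finite.injective_iff_surjective.mpr hfs, hfs⟩
    refine ⟨TG (gM (I := I) K) (Equiv.ofBijective f hfb), Submodule.subset_span ⟨_, ?_, rfl⟩, ?_⟩
    · intro k
      have := hL _ (hf k)
      simpa [vH] using this
    · rw [AlgHom.toLinearMap_apply, psi_TG]
      have hLm : (L : Multiset (I × I)) = Finset.univ.val.map (fun k => (k, f k)) := by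
        rw [Multiset.Nodup.ext (Multiset.coe_nodup.mpr (List.Nodup.of_map _ hn2))
          (Finset.univ.nodup.map (fun a b h => by simpa using congrArg Prod.fst h))]
        rintro ⟨a, b⟩
        simp only [Multiset.mem_coe, Multiset.mem_map, Finset.mem_val, Finset.mem_univ, true_and,
          Prod.mk.injEq]
        constructor
        · intro h
          refine ⟨a, rfl, ?_⟩
          exact congrArg Prod.snd (hinj (hf a) h rfl)
        · rintro ⟨_, rfl, rfl⟩
          exact hf _
      have h5 : (L.map (fun p => bk (cV I K) (p.1, 1) (p.2, 0))).prod =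
        ((L : Multiset (I × I)).map (fun p => bk (cV I K) (p.1, 1) (p.2, 0))).prod := by simp
      rw [h5, hLm, Multiset.map_map]
      rfl
  obtain ⟨G, h1, h2⟩ := this hy
  exact ⟨G, h1, h2⟩

theorem MLI_span {I V K : Type} [Field K] [Fintype I] (s t : I → V) (F : RM I K) (hF : MLI s t F)
    (hb : (Finset.univ : Finset I).val.map t = Finset.univ.val.map s) :
    F ∈ Submodule.span K {x | ∃ τ : Equiv.Perm I, (∀ k, s k = t (τ k)) ∧
      x = TG (gM (I := I) K) τ} := by
  have h1 : psi Set.univ F ∈ MS (K := K) (vH s t) (cV I K) (Finset.univ : Finset (I × Fin 2)).val := by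
    refine Submodule.span_le.mpr ?_ hF.2
    rintro y ⟨l, hl, rfl⟩
    rw [← hl]
    apply br_mixed _ _ _ l rfl
    intro v
    rw [hl, univ_half]
    have := congrArg (Multiset.count v) hb
    rw [Multiset.count_map, Multiset.count_map] at this
    rw [cnt_add, cnt_add, cnt_map, cnt_map, cnt_map, cnt_map]
    simpa [vH, eq_comm] using this.symm
  obtain ⟨G, hG, hGF⟩ := MS_perm s t _ h1
  have hGw : IsWeightedHomogeneous (wA I) G Finset.univ.val := by
    rw [← mem_weightedHomogeneousSubmodule]
    refine Submodule.span_le.mpr ?_ hG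
    rintro x ⟨τ, _, rfl⟩
    exact TG_wh τ
  have : F - G = 0 := by
    apply ml_inj _ (hF.1.sub hGw)
    rw [map_sub, hGF, sub_self]
  rw [sub_eq_zero.mp this]
  exact hG

end QFFT

namespace QFFT
open MvPolynomial

section paths
variable (Q : QuiverData) (K : Type) [Field K]

lemma path_append : ∀ (l1 l2 : List Q.A) (u v w : Q.V), Q.IsPathFrom u v l1 → Q.IsPathFrom v w l2 →
    Q.IsPathFrom u w (l1 ++ l2)
  | [], l2, u, v, w, h1, h2 => by
    have h1' : u = v := h1
    rw [h1']; exact h2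
  | a :: l1, l2, u, v, w, h1, h2 => ⟨h1.1, path_append l1 l2 _ v w h1.2 h2⟩

lemma pathMat_append (l1 l2 : List Q.A) :
    Q.pathMat K (l1 ++ l2) = Q.pathMat K l2 * Q.pathMat K l1 := by
  simp [QuiverData.pathMat]

lemma pathMat_cons (a : Q.A) (l : List Q.A) :
    Q.pathMat K (a :: l) = Q.pathMat K l * Q.genMat K a := by
  simp [QuiverData.pathMat]

lemma genMat_act (g : Q.V → Matrix (Fin 2) (Fin 2) K) (a : Q.A) :
    (Q.genMat K a).map (aeval (Q.actVar K g)) =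
      (g (Q.tgt a)).map C * Q.genMat K a * ((g (Q.src a))⁻¹).map C := by
  ext1 i j
  have h : aeval (Q.actVar K g) (X ((a, i, j) : Q.Var) : MvPolynomial Q.Var K) =
      Q.actVar K g (a, i, j) := aeval_X _ _
  have h' : (Q.genMat K a).map (aeval (Q.actVar K g)) i j = Q.actVar K g (a, i, j) := h
  have h3 : Q.actVar K g (a, i, j) = ∑ k : Fin 2, ∑ l : Fin 2,
      C (g (Q.tgt a) i k * (g (Q.src a))⁻¹ l j) * Q.genMat K a k l := rfl
  rw [h', h3]
  simp only [Matrix.map_apply, Matrix.mul_apply, Fin.sum_univ_two, C_mul]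
  ring

lemma pathMat_act (g : Q.V → Matrix (Fin 2) (Fin 2) K) (hg : ∀ v, IsUnit (g v).det) :
    ∀ (l : List Q.A) (u v : Q.V), Q.IsPathFrom u v l →
    (Q.pathMat K l).map (aeval (Q.actVar K g)) =
      (g v).map C * Q.pathMat K l * ((g u)⁻¹).map C
  | [], u, v, h => by
    have h' : u = v := h
    subst h'
    simp only [QuiverData.pathMat, List.map_nil, List.reverse_nil, List.prod_nil, mul_one]
    rw [← Matrix.map_mul, Matrix.mul_nonsing_inv _ (hg u), Matrix.map_one _ C_0 C_1,
      Matrix.map_one _ (map_zero _) (map_one _)]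
  | a :: l, u, v, h => by
    rw [pathMat_cons, Matrix.map_mul, pathMat_act g hg l _ v h.2, genMat_act, ← h.1]
    have e : ((g (Q.tgt a))⁻¹).map (C : K → MvPolynomial Q.Var K) * (g (Q.tgt a)).map C = 1 := by
      rw [← Matrix.map_mul, Matrix.nonsing_inv_mul _ (hg _), Matrix.map_one _ C_0 C_1]
    calc _ = (g v).map C * Q.pathMat K l * (((g (Q.tgt a))⁻¹).map C * (g (Q.tgt a)).map C) *
          Q.genMat K a * ((g (Q.src a))⁻¹).map C := by noncomm_ring
      _ = _ := by rw [e, Matrix.mul_one]; noncomm_ring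

lemma pathTr_inv (c : List Q.A) (v : Q.V) (hc : Q.IsPathFrom v v c) :
    Q.IsInvariant K (Q.pathTr K c) := by
  intro g hg
  have h1 : aeval (Q.actVar K g) (Q.pathTr K c) =
      Matrix.trace ((Q.pathMat K c).map (aeval (Q.actVar K g))) := by
    simp [QuiverData.pathTr, Matrix.trace]
  rw [h1, pathMat_act Q K g hg c v v hc, Matrix.trace_mul_comm, ← Matrix.mul_assoc,
    ← Matrix.map_mul, Matrix.nonsing_inv_mul _ (hg _), Matrix.map_one _ C_0 C_1, Matrix.one_mul]
  rfl

lemma pathTr_cc (c : List Q.A) (hc : c ≠ []) : constantCoeff (Q.pathTr K c) = 0 := by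
  obtain ⟨a, l, rfl⟩ := List.exists_cons_of_ne_nil hc
  rw [QuiverData.pathTr, pathMat_cons]
  have hX : ∀ i j, constantCoeff (Q.genMat K a i j) = 0 := fun i j => constantCoeff_X _ _
  simp [Matrix.trace, Matrix.mul_apply, hX]

lemma pathTr_plus (c : List Q.A) (hc : Q.IsClosed c) : Q.pathTr K c ∈ Q.PlusSet K := by
  obtain ⟨v, h1, h2⟩ := hc
  exact ⟨pathTr_inv Q K c v h2, pathTr_cc Q K c h1⟩

lemma plus_mul (x y : MvPolynomial Q.Var K) (hx : x ∈ Q.PlusSet K) (hy : y ∈ Q.PlusSet K) :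
    x * y ∈ Q.PlusSet K := by
  refine ⟨fun g hg => ?_, ?_⟩
  · rw [map_mul, hx.1 g hg, hy.1 g hg]
  · rw [map_mul, hx.2, zero_mul]

/-- decomposables -/
noncomputable def Dec : Submodule K (MvPolynomial Q.Var K) :=
  Submodule.span K {x : MvPolynomial Q.Var K | ∃ p ∈ Q.PlusSet K, ∃ q ∈ Q.PlusSet K, x = p * q}

lemma Dec_mul (x y : MvPolynomial Q.Var K) (hx : x ∈ Q.PlusSet K) (hy : y ∈ Q.PlusSet K) :
    x * y ∈ Dec Q K := Submodule.subset_span ⟨x, hx, y, hy, rfl⟩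

lemma tr_three {R : Type} [CommRing R] (A B C : Matrix (Fin 2) (Fin 2) R) :
    (C * B * A).trace + (B * C * A).trace = A.trace * (C * B).trace + B.trace * (C * A).trace +
      C.trace * (B * A).trace - A.trace * (B.trace * C.trace) := by
  simp only [Matrix.trace, Matrix.mul_apply, Fin.sum_univ_two, Matrix.diag_apply]
  ring

lemma closedAt_append (v : Q.V) (a b : List Q.A) (ha : Q.IsClosedAt v a) (hb : Q.IsClosedAt v b) :
    Q.IsClosedAt v (a ++ b) :=
  ⟨by simp [ha.1], path_append Q a b v v v ha.2 hb.2⟩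

lemma dec_three (v : Q.V) (a b c : List Q.A) (ha : Q.IsClosedAt v a) (hb : Q.IsClosedAt v b)
    (hc : Q.IsClosedAt v c) :
    Q.pathTr K (a ++ (b ++ c)) + Q.pathTr K (a ++ (c ++ b)) ∈ Dec Q K := by
  have P := fun l (h : Q.IsClosedAt v l) => pathTr_plus Q K l ⟨v, h⟩
  have e : Q.pathTr K (a ++ (b ++ c)) + Q.pathTr K (a ++ (c ++ b)) =
      Q.pathTr K a * Q.pathTr K (b ++ c) + Q.pathTr K b * Q.pathTr K (a ++ c) +
      Q.pathTr K c * Q.pathTr K (a ++ b) - Q.pathTr K a * (Q.pathTr K b * Q.pathTr K c) := by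
    simp only [QuiverData.pathTr, pathMat_append]
    exact tr_three _ _ _
  rw [e]
  have A := closedAt_append Q v
  refine Submodule.sub_mem _ (Submodule.add_mem _ (Submodule.add_mem _ ?_ ?_) ?_) ?_
  · exact Dec_mul Q K _ _ (P _ ha) (P _ (A _ _ hb hc))
  · exact Dec_mul Q K _ _ (P _ hb) (P _ (A _ _ ha hc))
  · exact Dec_mul Q K _ _ (P _ hc) (P _ (A _ _ ha hb))
  · exact Dec_mul Q K _ _ (P _ ha) (plus_mul Q K _ _ (P _ hb) (P _ hc))

lemma dec_four (h2 : (2 : K) ≠ 0) (v : Q.V) (a b c d : List Q.A) (ha : Q.IsClosedAt v a)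
    (hb : Q.IsClosedAt v b) (hc : Q.IsClosedAt v c) (hd : Q.IsClosedAt v d) :
    Q.pathTr K (a ++ (b ++ (c ++ d))) ∈ Dec Q K := by
  have A := closedAt_append Q v
  have h1 := dec_three Q K v a b (c ++ d) ha hb (A _ _ hc hd)
  have h3 := dec_three Q K v a c (d ++ b) ha hc (A _ _ hd hb)
  have h4 := dec_three Q K v a d (b ++ c) ha hd (A _ _ hb hc)
  simp only [List.append_assoc] at h1 h3 h4
  have h5 := Submodule.smul_mem _ (2⁻¹ : K) (Submodule.add_mem _ (Submodule.sub_mem _ h1 h3) h4)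
  convert h5 using 1
  have : ∀ x y z : MvPolynomial Q.Var K, (x + y - (y + z) + (z + x)) = (2 : K) • x := by
    intro x y z
    rw [two_smul]; ring
  rw [this, smul_smul, inv_mul_cancel₀ h2, one_smul]

lemma split_path (w : Q.V) : ∀ (l : List Q.A) (u v : Q.V) (k : ℕ), Q.IsPathFrom u v l →
    k + 1 ≤ (l.map Q.tgt).count w → ∃ l1 l2, l = l1 ++ l2 ∧ l1 ≠ [] ∧ Q.IsPathFrom u w l1 ∧
      Q.IsPathFrom w v l2 ∧ k ≤ (l2.map Q.tgt).count w
  | [], u, v, k, h, hk => by simp at hk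
  | a :: l, u, v, k, h, hk => by
    by_cases ha : Q.tgt a = w
    · refine ⟨[a], l, rfl, by simp, ⟨h.1, ha⟩, ha ▸ h.2, ?_⟩
      rw [List.map_cons, ha, List.count_cons_self] at hk
      omega
    · rw [List.map_cons, List.count_cons_of_ne ha] at hk
      obtain ⟨l1, l2, e1, e2, e3, e4, e5⟩ := split_path w l _ v k h.2 hk
      exact ⟨a :: l1, l2, by rw [e1]; rfl, by simp, ⟨h.1, e3⟩, e4, e5⟩

lemma dec_long (h2 : (2 : K) ≠ 0) [Fintype Q.V] (c : List Q.A) (hc : Q.IsClosed c)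
    (hlen : 3 * Fintype.card Q.V < c.length) : Q.pathTr K c ∈ Dec Q K := by
  obtain ⟨v, hne, hp⟩ := hc
  obtain ⟨w, hw⟩ : ∃ w, 3 + 1 ≤ (c.map Q.tgt).count w := by
    by_contra hcon
    push Not at hcon
    have h3 : ∑ w : Q.V, (c.map Q.tgt).count w = c.length := by
      have := Multiset.sum_count_eq_card (s := Finset.univ) (m := (c.map Q.tgt : Multiset Q.V))
        (fun a _ => Finset.mem_univ a)
      simpa using this
    have h4 : ∑ w : Q.V, (c.map Q.tgt).count w ≤ ∑ _w : Q.V, 3 :=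
      Finset.sum_le_sum (fun w _ => by have := hcon w; omega)
    simp at h4
    omega
  obtain ⟨l0, r0, e0, n0, p0, q0, k0⟩ := split_path Q w c v v 3 hp hw
  obtain ⟨l1, r1, e1, n1, p1, q1, k1⟩ := split_path Q w r0 w v 2 q0 k0
  obtain ⟨l2, r2, e2, n2, p2, q2, k2⟩ := split_path Q w r1 w v 1 q1 k1
  obtain ⟨l3, r3, e3, n3, p3, q3, k3⟩ := split_path Q w r2 w v 0 q2 k2
  have h3 := dec_four Q K h2 w l1 l2 l3 (r3 ++ l0) ⟨n1, p1⟩ ⟨n2, p2⟩ ⟨n3, p3⟩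
    ⟨by simp [n0], path_append Q _ _ _ _ _ q3 p0⟩
  have e : Q.pathTr K c = Q.pathTr K (l1 ++ (l2 ++ (l3 ++ (r3 ++ l0)))) := by
    rw [e0, e1, e2, e3, QuiverData.pathTr, pathMat_append, Matrix.trace_mul_comm, ← pathMat_append,
      QuiverData.pathTr]
    simp only [List.append_assoc]
  rw [e]; exact h3

lemma dec_prod (h2 : (2 : K) ≠ 0) [Fintype Q.V] (L : List (List Q.A)) (hL : ∀ c ∈ L, Q.IsClosed c)
    (hlen : 3 * Fintype.card Q.V < L.flatten.length) : (L.map (Q.pathTr K)).prod ∈ Dec Q K := by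
  match L, hL, hlen with
  | [], _, h => simp at h
  | [c], hL, h =>
    simp only [List.map_cons, List.map_nil, List.prod_cons, List.prod_nil, mul_one]
    exact dec_long Q K h2 c (hL c (by simp)) (by simpa using h)
  | c :: d :: L, hL, _ =>
    have key : ∀ (L : List (List Q.A)) (d : List Q.A), (∀ c ∈ d :: L, Q.IsClosed c) →
        ((d :: L).map (Q.pathTr K)).prod ∈ Q.PlusSet K := by
      intro L
      induction L with
      | nil => intro d hd; simpa using pathTr_plus Q K d (hd d (by simp))
      | cons e L ih =>
        intro d hd
        rw [List.map_cons, List.prod_cons]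
        exact plus_mul Q K _ _ (pathTr_plus Q K d (hd d (by simp)))
          (ih e (fun c hc => hd c (List.mem_cons_of_mem _ hc)))
    rw [List.map_cons, List.prod_cons]
    exact Dec_mul Q K _ _ (pathTr_plus Q K c (hL c (by simp)))
      (key L d (fun c hc => hL c (List.mem_cons_of_mem _ hc)))

end paths

end QFFT

namespace QFFT
open MvPolynomial

lemma TG_equiv {I J R : Type} [Fintype I] [Fintype J] [CommRing R] (e : I ≃ J)
    (M : J → Matrix (Fin 2) (Fin 2) R) (τ : Equiv.Perm J) :
    TG M τ = TG (fun k => M (e k)) ((e.trans τ).trans e.symm) := by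
  unfold TG
  apply Fintype.sum_equiv (Equiv.arrowCongr e.symm (Equiv.refl (Fin 2)))
  intro i
  rw [← e.prod_comp]
  simp

lemma TG_option {J R : Type} [Fintype J] [CommRing R] (M : Option J → Matrix (Fin 2) (Fin 2) R)
    (τ : Equiv.Perm (Option J)) :
    TG M τ = ∑ i : J → Fin 2, ∑ i0 : Fin 2, M none i0 ((τ none).elim i0 i) *
      ∏ k, M (some k) (i k) ((τ (some k)).elim i0 i) := by
  rw [Finset.sum_comm, ← Fintype.sum_prod_type']
  unfold TG
  have key : ∀ (_ : Fintype (Option J → Fin 2)) (F : (Option J → Fin 2) → R) (G : Fin 2 × (J → Fin 2) → R),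
      (∀ x, F x = G (Equiv.piOptionEquivProd (β := fun _ : Option J => Fin 2) x)) →
      ∑ x, F x = ∑ x, G x := by
    intro _ F G h
    convert Fintype.sum_equiv (Equiv.piOptionEquivProd (β := fun _ : Option J => Fin 2)) F G h
  refine key _ _ _ ?_
  intro i
  have h : ∀ o : Option J, o.elim (i none) (fun k => i (some k)) = i o := by
    intro o; cases o <;> rfl
  rw [Fintype.prod_option]
  simp [Equiv.piOptionEquivProd, h]

lemma TG_fix {J R : Type} [Fintype J] [CommRing R] (M : Option J → Matrix (Fin 2) (Fin 2) R)
    (τ : Equiv.Perm (Option J)) (h : τ none = none) (σ : Equiv.Perm J)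
    (hσ : ∀ k, τ (some k) = some (σ k)) :
    TG M τ = (M none).trace * TG (fun k => M (some k)) σ := by
  rw [TG_option]
  simp only [h, hσ, Option.elim_none, Option.elim_some]
  rw [TG, Matrix.trace, Finset.sum_mul_sum, Finset.sum_comm]
  rfl

lemma TG_merge {J R : Type} [Fintype J] [CommRing R] (M : Option J → Matrix (Fin 2) (Fin 2) R)
    (τ : Equiv.Perm (Option J)) (a b : J) (h : τ none = some b) (ha : τ (some a) = none)
    (σ : Equiv.Perm J) (hσa : σ a = b) (hσ : ∀ k, k ≠ a → τ (some k) = some (σ k)) :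
    TG M τ = TG (fun k => if k = a then M (some a) * M none else M (some k)) σ := by
  rw [TG_option, TG]
  apply Finset.sum_congr rfl
  intro i _
  have e1 : ∀ i0 : Fin 2, ∏ k, M (some k) (i k) ((τ (some k)).elim i0 i) =
      M (some a) (i a) i0 * ∏ k ∈ Finset.univ.erase a, M (some k) (i k) (i (σ k)) := by
    intro i0
    rw [← Finset.mul_prod_erase Finset.univ _ (Finset.mem_univ a), ha]
    congr 1
    apply Finset.prod_congr rfl
    intro k hk
    rw [hσ k (Finset.ne_of_mem_erase hk)]
    rfl
  rw [← Finset.mul_prod_erase Finset.univ _ (Finset.mem_univ a)]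
  simp only [e1, h, Option.elim_some, if_true, hσa]
  rw [Matrix.mul_apply, Finset.sum_mul]
  apply Finset.sum_congr rfl
  intro i0 _
  have e2 : ∏ k ∈ Finset.univ.erase a, (if k = a then M (some a) * M none else M (some k)) (i k) (i (σ k)) =
      ∏ k ∈ Finset.univ.erase a, M (some k) (i k) (i (σ k)) := by
    apply Finset.prod_congr rfl
    intro k hk
    rw [if_neg (Finset.ne_of_mem_erase hk)]
  rw [e2]
  ring

/-- the statement that contractions are products of traces -/
def TrP (Q : QuiverData) (K : Type) [Field K] (I : Type) [Fintype I] : Prop :=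
  ∀ (l : I → List Q.A) (s t : I → Q.V) (τ : Equiv.Perm I),
    (∀ k, l k ≠ [] ∧ Q.IsPathFrom (s k) (t k) (l k)) → (∀ k, s k = t (τ k)) →
    ∃ L : List (List Q.A), (∀ c ∈ L, Q.IsClosed c) ∧
      TG (fun k => Q.pathMat K (l k)) τ = (L.map (Q.pathTr K)).prod ∧
      L.flatten.length = ∑ k, (l k).length

lemma trP (Q : QuiverData) (K : Type) [Field K] : ∀ (I : Type) [Fintype I], TrP Q K I := by
  intro I hI
  refine Fintype.induction_empty_option (P := fun I _ => TrP Q K I) ?_ ?_ ?_ I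
  · intro I J _ e h l s t τ hl hs
    letI := Fintype.ofEquiv J e.symm
    obtain ⟨L, h1, h2, h3⟩ := h (fun k => l (e k)) (fun k => s (e k)) (fun k => t (e k))
      ((e.trans τ).trans e.symm) (fun k => hl (e k)) (fun k => by simpa using hs (e k))
    refine ⟨L, h1, ?_, ?_⟩
    · rw [← h2, TG_equiv e]
    · rw [h3, ← e.sum_comp]
  · intro l s t τ hl hs
    refine ⟨[], by simp, ?_, by simp⟩
    simp [TG]
  · intro J _ ih l s t τ hl hs
    by_cases hn : τ none = none
    · have hσ : ∀ k, τ (some k) = some (Equiv.removeNone τ k) := by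
        intro k
        rw [Equiv.removeNone_some]
        by_contra hcon
        push Not at hcon
        have h0 : τ (some k) = none := by
          cases hh : τ (some k) with
          | none => rfl
          | some x => exact absurd hh (hcon x)
        have := τ.injective (h0.trans hn.symm)
        simp at this
      obtain ⟨L, h1, h2, h3⟩ := ih (fun k => l (some k)) (fun k => s (some k)) (fun k => t (some k))
        (Equiv.removeNone τ) (fun k => hl (some k)) (fun k => by
          have := hs (some k)
          rwa [hσ] at this)
      refine ⟨l none :: L, ?_, ?_, ?_⟩
      · intro c hc
        rcases List.mem_cons.mp hc with rfl | hc
        · refine ⟨s none, (hl none).1, ?_⟩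
          have h4 := (hl none).2
          have h5 := hs none
          rw [hn] at h5
          rwa [← h5] at h4
        · exact h1 c hc
      · rw [TG_fix _ τ hn _ hσ, h2]
        rfl
      · rw [Fintype.sum_option, List.flatten_cons, List.length_append, h3]
    · obtain ⟨b, hb⟩ := Option.ne_none_iff_exists'.mp hn
      obtain ⟨a, ha⟩ : ∃ a, τ (some a) = none := by
        obtain ⟨o, ho⟩ := τ.surjective none
        cases o with
        | none => exact absurd ho hn
        | some a => exact ⟨a, ho⟩
      have hσa : Equiv.removeNone τ a = b := by
        have := Equiv.removeNone_none τ ha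
        rw [hb] at this
        exact Option.some_injective _ this
      have hσ : ∀ k, k ≠ a → τ (some k) = some (Equiv.removeNone τ k) := by
        intro k hk
        rw [Equiv.removeNone_some]
        by_contra hcon
        push Not at hcon
        have h0 : τ (some k) = none := by
          cases hh : τ (some k) with
          | none => rfl
          | some x => exact absurd hh (hcon x)
        have := τ.injective (h0.trans ha.symm)
        exact hk (Option.some_injective _ this)
      obtain ⟨L, h1, h2, h3⟩ := ih (fun k => if k = a then l none ++ l (some a) else l (some k))
        (fun k => if k = a then s none else s (some k)) (fun k => t (some k))
        (Equiv.removeNone τ) (fun k => by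
          by_cases hk : k = a
          · subst hk
            simp only [if_true]
            refine ⟨by simp [(hl none).1], path_append Q _ _ _ _ _ (hl none).2 ?_⟩
            have h5 := hs (some k)
            rw [ha] at h5
            rw [← h5]
            exact (hl (some k)).2
          · simp only [hk, if_false]
            exact hl (some k)) (fun k => by
          by_cases hk : k = a
          · subst hk
            simp only [if_true]
            rw [hσa, ← hb]
            exact hs none
          · simp only [hk, if_false]
            rw [← hσ k hk]
            exact hs (some k))
      refine ⟨L, h1, ?_, ?_⟩
      · rw [← h2, TG_merge _ τ a b hb ha _ hσa hσ]
        congr 1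
        funext k
        by_cases hk : k = a
        · simp [hk, pathMat_append]
        · simp [hk]
      · rw [h3, Fintype.sum_option, ← Finset.add_sum_erase Finset.univ _ (Finset.mem_univ a),
          ← Finset.add_sum_erase Finset.univ (fun k => (l (some k)).length) (Finset.mem_univ a)]
        simp only [if_true, List.length_append]
        rw [add_assoc]
        congr 2
        apply Finset.sum_congr rfl
        intro k hk
        rw [if_neg (Finset.ne_of_mem_erase hk)]

end QFFT

namespace QFFT
open MvPolynomial

lemma wcomp_comm {σ M K : Type} [Field K] [AddCommMonoid M] (w : σ → M) (G : σ → MvPolynomial σ K)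
    (hG : ∀ v, IsWeightedHomogeneous w (G v) (w v)) (α : M) (f : MvPolynomial σ K) :
    weightedHomogeneousComponent w α (aeval G f) = aeval G (weightedHomogeneousComponent w α f) := by
  induction f using MvPolynomial.induction_on' with
  | add p q hp hq => rw [map_add, map_add, hp, hq, map_add, map_add]
  | monomial m c =>
    have h1 : IsWeightedHomogeneous w (monomial m c) (Finsupp.weight w m) :=
      isWeightedHomogeneous_monomial w m c rfl
    have h2 : IsWeightedHomogeneous w (aeval G (monomial m c)) (Finsupp.weight w m) :=
      wh_aeval w w (AddMonoidHom.id M) G hG _ _ h1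
    by_cases h : α = Finsupp.weight w m
    · subst h
      rw [h1.weightedHomogeneousComponent_same, h2.weightedHomogeneousComponent_same]
    · rw [h1.weightedHomogeneousComponent_ne _ h, h2.weightedHomogeneousComponent_ne _ h, map_zero]

/-- the transported action -/
noncomputable def linV {A V K : Type} [Field K] (s t : A → V) (g : V → Matrix (Fin 2) (Fin 2) K)
    (p : (A × Fin 2) × Fin 2) : RM A K :=
  ∑ k : Fin 2, ∑ l : Fin 2, C (g (t p.1.1) p.1.2 k * (g (s p.1.1))⁻¹ l p.2) * X ((p.1.1, k), l)

lemma linV_wh {A V K : Type} [Field K] (s t : A → V) (g : V → Matrix (Fin 2) (Fin 2) K)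
    (p : (A × Fin 2) × Fin 2) : IsWeightedHomogeneous (wA A) (linV s t g p) (wA A p) := by
  apply IsWeightedHomogeneous.sum
  intro k _
  apply IsWeightedHomogeneous.sum
  intro l _
  have := (isWeightedHomogeneous_C (wA A)
    (g (t p.1.1) p.1.2 k * (g (s p.1.1))⁻¹ l p.2)).mul
    (isWeightedHomogeneous_X K (wA A) ((p.1.1, k), l))
  rwa [zero_add] at this

lemma actS_eq_linV {A V K : Type} [Field K] (s t : A → V) (g : V → Matrix (Fin 2) (Fin 2) K)
    (hg : ∀ v, (g v).det = 1) (f : RM A K) : actS s t ∅ g f = aeval (linV s t g) f := by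
  unfold actS linV
  congr 2
  funext p
  simp [Matrix.inv_def, hg]

/-- reassociation of variables -/
def rho (Q : QuiverData) (p : Q.Var) : (Q.A × Fin 2) × Fin 2 := ((p.1, p.2.1), p.2.2)

/-- inverse reassociation of variables -/
def rhoi (Q : QuiverData) (p : (Q.A × Fin 2) × Fin 2) : Q.Var := (p.1.1, p.1.2, p.2)

lemma rho_act (Q : QuiverData) (K : Type) [Field K] (g : Q.V → Matrix (Fin 2) (Fin 2) K)
    (f : MvPolynomial Q.Var K) :
    rename (rho Q) (aeval (Q.actVar K g) f) = aeval (linV Q.src Q.tgt g) (rename (rho Q) f) := by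
  have : ((rename (rho Q)).comp (aeval (Q.actVar K g)) : MvPolynomial Q.Var K →ₐ[K] RM Q.A K) =
      (aeval (linV Q.src Q.tgt g)).comp (rename (rho Q)) := by
    apply MvPolynomial.algHom_ext
    intro p
    rw [AlgHom.comp_apply, AlgHom.comp_apply, aeval_X, rename_X, aeval_X]
    have h3 : Q.actVar K g p = ∑ k : Fin 2, ∑ l : Fin 2,
      C (g (Q.tgt p.1) p.2.1 k * (g (Q.src p.1))⁻¹ l p.2.2) * Q.genMat K p.1 k l := rfl
    have h4 : ∀ k l, rename (rho Q) (Q.genMat K p.1 k l) = X ((p.1, k), l) :=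
      fun k l => rename_X _ _
    have h5 : linV Q.src Q.tgt g (rho Q p) = ∑ k : Fin 2, ∑ l : Fin 2,
      C (g (Q.tgt p.1) p.2.1 k * (g (Q.src p.1))⁻¹ l p.2.2) * X ((p.1, k), l) := rfl
    rw [h3, h5, map_sum]
    apply Finset.sum_congr rfl
    intro k _
    rw [map_sum]
    apply Finset.sum_congr rfl
    intro l _
    rw [map_mul, rename_C, h4]
  exact DFunLike.congr_fun this f

lemma card_wA {I : Type} (m : (I × Fin 2) × Fin 2 →₀ ℕ) :
    Multiset.card (Finsupp.weight (wA I) m) = m.degree := by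
  induction m using Finsupp.induction_linear with
  | zero => simp
  | add f g hf hg => rw [map_add, Multiset.card_add, hf, hg, map_add]
  | single v n => rw [Finsupp.weight_single, wA, Multiset.card_nsmul]; simp

lemma aeval_scal {A K : Type} [Field K] (χ : A → K) (f : RM A K) (α : Multiset A)
    (hf : IsWeightedHomogeneous (wA A) f α) :
    aeval (fun p : (A × Fin 2) × Fin 2 => C (χ p.1.1) * (X p : RM A K)) f = C (α.map χ).prod * f := by
  have key : ∀ (m : (A × Fin 2) × Fin 2 →₀ ℕ) (c : K),
      aeval (fun p : (A × Fin 2) × Fin 2 => C (χ p.1.1) * (X p : RM A K)) (monomial m c) =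
      C ((Finsupp.weight (wA A) m).map χ).prod * monomial m c := by
    intro m
    induction m using Finsupp.induction_linear with
    | zero => intro c; simp
    | add f g hf hg =>
      intro c
      have e : (monomial (f + g) c : RM A K) = monomial f 1 * monomial g c := by
        rw [monomial_mul, one_mul]
      rw [e, map_mul, hf, hg, map_add, Multiset.map_add, Multiset.prod_add, C_mul]
      ring
    | single v n =>
      intro c
      rw [Finsupp.weight_single, wA, Multiset.map_nsmul, Multiset.prod_nsmul, aeval_monomial]
      simp only [Multiset.map_singleton, Multiset.prod_singleton]
      rw [Finsupp.prod_single_index (by simp), mul_pow, algebraMap_eq, ← C_mul_X_pow_eq_monomial,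
        C_pow]
      ring
  conv_lhs => rw [f.as_sum]
  conv_rhs => rw [f.as_sum]
  rw [map_sum, Finset.mul_sum]
  apply Finset.sum_congr rfl
  intro m hm
  rw [key, hf (mem_support_iff.mp hm)]

lemma prod_ite_count {V K : Type} [Field K] (m : Multiset V) (v : V) (c : K) :
    (m.map (fun u => if u = v then c else 1)).prod = c ^ m.count v := by
  induction m using Multiset.induction_on with
  | empty => simp
  | cons a m ih =>
    rw [Multiset.map_cons, Multiset.prod_cons, ih]
    by_cases h : a = v
    · subst h; simp [pow_succ']
    · rw [if_neg h, one_mul, Multiset.count_cons_of_ne (Ne.symm h)]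

lemma pow_eq_all {K : Type} [Field K] [Infinite K] (p q : ℕ) (h : ∀ c : K, c ≠ 0 → c ^ p = c ^ q) :
    p = q := by
  have h1 : (Polynomial.X ^ (p + 1) : Polynomial K) = Polynomial.X ^ (q + 1) := by
    apply Polynomial.funext
    intro c
    simp only [Polynomial.eval_pow, Polynomial.eval_X]
    by_cases hc : c = 0
    · simp [hc]
    · rw [pow_succ, pow_succ, h c hc]
  have h2 := congrArg Polynomial.natDegree h1
  simpa using h2

lemma balanced {A V K : Type} [Field K] [Infinite K] (s t : A → V) (f : RM A K) (hf0 : f ≠ 0)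
    (α : Multiset A) (hf : IsWeightedHomogeneous (wA A) f α)
    (hi : ∀ g : V → Matrix (Fin 2) (Fin 2) K, (∀ v, IsUnit (g v).det) →
      aeval (linV s t g) f = f) : α.map t = α.map s := by
  ext v
  apply pow_eq_all (K := K)
  intro c hc
  have hcu : ∀ u, (if u = v then c else 1) ≠ 0 := by
    intro u; split_ifs <;> simp [hc]
  have h := hi (fun u => (if u = v then c else 1) • (1 : Matrix (Fin 2) (Fin 2) K)) (fun u => by
    rw [Matrix.det_smul, Matrix.det_one, mul_one]
    exact (IsUnit.mk0 _ (hcu u)).pow _)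
  have e : linV s t (fun u => (if u = v then c else 1) • (1 : Matrix (Fin 2) (Fin 2) K)) =
      fun p => C ((if t p.1.1 = v then c else 1) * (if s p.1.1 = v then c else 1)⁻¹) *
        (X p : RM A K) := by
    have hinv : ∀ u, ((if u = v then c else 1) • (1 : Matrix (Fin 2) (Fin 2) K))⁻¹ =
        (if u = v then c else 1)⁻¹ • (1 : Matrix (Fin 2) (Fin 2) K) := by
      intro u
      apply Matrix.inv_eq_right_inv
      rw [Matrix.smul_mul, Matrix.one_mul, smul_smul, mul_inv_cancel₀ (hcu u), one_smul]
    funext p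
    obtain ⟨⟨a, i⟩, j⟩ := p
    unfold linV
    simp only [hinv, Matrix.smul_apply, smul_eq_mul]
    fin_cases i <;> fin_cases j <;> simp [Fin.sum_univ_two, Matrix.one_apply]
  rw [e, aeval_scal (fun a => (if t a = v then c else 1) * (if s a = v then c else 1)⁻¹) f α hf] at h
  have h1 : (C (α.map (fun a => (if t a = v then c else 1) * (if s a = v then c else 1)⁻¹)).prod :
      RM A K) = 1 := by
    apply mul_right_cancel₀ hf0
    rw [h, one_mul]
  rw [← C_1] at h1
  have h2 := C_injective _ _ h1
  rw [Multiset.prod_map_mul, Multiset.prod_map_inv] at h2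
  have h3 := prod_ite_count (α.map t) v c
  have h4 := prod_ite_count (α.map s) v c
  rw [Multiset.map_map] at h3 h4
  simp only [Function.comp_def] at h3 h4
  rw [h3, h4] at h2
  exact (mul_inv_eq_one₀ (pow_ne_zero _ hc)).mp h2

lemma final_comp (Q : QuiverData) (K : Type) [Field K] [Infinite K] [Fintype Q.V] [Fintype Q.A]
    (h2 : (2 : K) ≠ 0) (f : RM Q.A K) (hf0 : f ≠ 0)
    (α : Multiset Q.A) (hf : IsWeightedHomogeneous (wA Q.A) f α)
    (hi : ∀ g : Q.V → Matrix (Fin 2) (Fin 2) K, (∀ v, IsUnit (g v).det) →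
      aeval (linV Q.src Q.tgt g) f = f) (hα : 3 * Fintype.card Q.V < α.card) :
    rename (rhoi Q) f ∈ Dec Q K := by
  have hb := balanced Q.src Q.tgt f hf0 α hf hi
  have h1 := fft_mat h2 Q.src Q.tgt α f hf (fun g hg => by
    rw [actS_eq_linV _ _ g hg]
    exact hi g (fun v => by rw [hg]; exact isUnit_one))
  suffices hs : TT K Q.src Q.tgt α ≤ (Dec Q K).comap (rename (rhoi Q)).toLinearMap from hs h1
  refine Submodule.span_le.mpr ?_
  rintro x ⟨I, _, e, F, he, hF, rfl⟩
  have h3 := MLI_span _ _ F hF (by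
    rw [← he, Multiset.map_map, Multiset.map_map] at hb
    exact hb)
  suffices hs : Submodule.span K {x | ∃ τ : Equiv.Perm I, (∀ k, Q.src (e k) = Q.tgt (e (τ k))) ∧
      x = TG (gM (I := I) K) τ} ≤
      (Dec Q K).comap ((rename (rhoi Q)).comp (rename (rnm e))).toLinearMap from hs h3
  refine Submodule.span_le.mpr ?_
  rintro x ⟨τ, hτ, rfl⟩
  obtain ⟨L, hL1, hL2, hL3⟩ := trP Q K I (fun k => [e k]) (fun k => Q.src (e k))
    (fun k => Q.tgt (e k)) τ (fun k => ⟨by simp, rfl, rfl⟩) hτ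
  have hlen : L.flatten.length = α.card := by
    rw [hL3, ← he]; simp
  have h5 := dec_prod Q K h2 L hL1 (by rw [hlen]; exact hα)
  rw [← hL2] at h5
  have h6 : rename (rhoi Q) (rename (rnm e) (TG (gM (I := I) K) τ)) =
      TG (fun k => Q.pathMat K [e k]) τ := by
    unfold TG
    simp only [map_sum, map_prod]
    apply Finset.sum_congr rfl
    intro i _
    apply Finset.prod_congr rfl
    intro k _
    rw [gM, rename_X, rename_X, pathMat_cons, QuiverData.pathMat]
    simp only [List.map_nil, List.reverse_nil, List.prod_nil, one_mul]
    rfl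
  change rename (rhoi Q) (rename (rnm e) (TG (gM (I := I) K) τ)) ∈ Dec Q K
  rw [h6]
  exact h5

lemma final_dec (Q : QuiverData) (K : Type) [Field K] [Infinite K] [Fintype Q.V] [Fintype Q.A]
    (h2 : (2 : K) ≠ 0) (f : MvPolynomial Q.Var K) (k : ℕ) (hf : Q.IsInvariant K f)
    (hhom : f.IsHomogeneous k) (hk : 3 * Fintype.card Q.V < k) : f ∈ Dec Q K := by
  set f' : RM Q.A K := rename (rho Q) f with hf'
  have hi : ∀ g : Q.V → Matrix (Fin 2) (Fin 2) K, (∀ v, IsUnit (g v).det) →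
      aeval (linV Q.src Q.tgt g) f' = f' := by
    intro g hg
    rw [hf', ← rho_act, hf g hg]
  have hh : f'.IsHomogeneous k := hhom.rename_isHomogeneous
  have hback : rename (rhoi Q) f' = f := by
    rw [hf', rename_rename]
    exact rename_id_apply f
  have hmem : f' ∈ (Dec Q K).comap (rename (rhoi Q)).toLinearMap := by
    rw [← sum_weightedHomogeneousComponent (wA Q.A) f']
    refine finsum_induction (fun x => x ∈ (Dec Q K).comap (rename (rhoi Q)).toLinearMap)
      (Submodule.zero_mem _) (fun x y hx hy => Submodule.add_mem _ hx hy) (fun α => ?_)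
    by_cases h0 : weightedHomogeneousComponent (wA Q.A) α f' = 0
    · rw [h0]; exact Submodule.zero_mem _
    · refine final_comp Q K h2 _ h0 α (weightedHomogeneousComponent_isWeightedHomogeneous α f')
        (fun g hg => ?_) ?_
      · rw [← wcomp_comm _ _ (linV_wh _ _ g), hi g hg]
      · obtain ⟨m, hm⟩ := ne_zero_iff.mp h0
        rw [coeff_weightedHomogeneousComponent] at hm
        split_ifs at hm with hw
        · rw [← hw, card_wA]
          have := hh hm
          have hd : Finsupp.degree m = Finsupp.weight 1 m :=
            DFunLike.congr_fun Finsupp.degree_eq_weight_one m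
          omega
        · exact absurd rfl hm
  have h3 : rename (rhoi Q) f' ∈ Dec Q K := hmem
  rwa [hback] at h3

theorem final_thm
    (K : Type) [Field K] [Infinite K] (hchar : ringChar K ≠ 2)
    (Q : QuiverData) [Fintype Q.V] [Fintype Q.A] (n : ℕ)
    (hn : Fintype.card Q.V = n) 
    (f : MvPolynomial Q.Var K) (k : ℕ)
    (hf : Q.IsInvariant K f) (hhom : f.IsHomogeneous k)
    (hind : ¬ Q.Decomposable K f) :
    k ≤ 3 * n := by
  by_contra hcon
  exact hind (final_dec Q K (Ring.two_ne_zero hchar) f k hf hhom (by rw [hn]; omega))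

end QFFT

/-- **Theorem (upper bound, char ≠ 2).** Let `K` be an infinite field with `char K ≠ 2`
and `Q` a strongly connected quiver with `n` vertices and `d ≥ 2` arrows.
Then `D(Q,(2,…,2)) ≤ 3n`: every indecomposable homogeneous invariant of
`Inv(Q,(2,…,2))` has degree at most `3n`. -/
theorem degree_bound_char_ne_two
    (K : Type) [Field K] [Infinite K] (hchar : ringChar K ≠ 2)
    (Q : QuiverData) [Fintype Q.V] [Fintype Q.A] (n d : ℕ)
    (hn : Fintype.card Q.V = n) (hd : Fintype.card Q.A = d) (hd2 : 2 ≤ d)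
    (hsc : Q.StronglyConnected)
    (f : MvPolynomial Q.Var K) (k : ℕ)
    (hf : Q.IsInvariant K f) (hhom : f.IsHomogeneous k)
    (hind : ¬ Q.Decomposable K f) :
    k ≤ 3 * n := by
  exact QFFT.final_thm K hchar Q n hn f k hf hhom hind
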